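/- arXiv:1402.0593 — 3 statements merged into one kernel-verified Lean document; each statement's English description precedes it below -/
import Mathlib

section
/- Let B = B(x₀, R) be an open ball in ℝ², let u, K : ℝ² → ℝ be continuously differentiable on a neighborhood of the closed ball with K > 0 there, and let z₁ ∈ ℝ². Then ∫_B div((z − z₁) K(z) e^{u(z)}) · log K(z) dz − ∫_{∂B} ⟨z − z₁, ν(z)⟩ K(z) e^{u(z)} log K(z) dσ(z) = ∫_B ⟨z − z₁, ∇u(z)⟩ (K(z) − K(z₁)) e^{u(z)} dz + 2 ∫_B (K(z) − K(z₁)) e^{u(z)} dz + ∫_{∂B} ⟨z − z₁, ν(z)⟩ (K(z₁) − K(z)) e^{u(z)} dσ(z), where div((z − z₁) K e^{u}) = 2 K e^{u} + ⟨z − z₁, ∇K⟩ e^{u} + K e^{u} ⟨z − z₁, ∇u⟩, ν(z) = (z − x₀)/R is the outward unit normal, and dσ is the arclength measure on the boundary circle ∂B. -/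
open MeasureTheory Metric Real
open scoped RealInnerProductSpace

section
open Set Filter Topology
open scoped ENNReal NNReal

theorem exists_pos_forall_abs_le_mul_abs_two_mul_sin_half {C : ℝ} (hC : 1 < C) :
    ∃ δ > 0, ∀ x : ℝ, |x| < δ → |x| ≤ C * |2 * sin (x / 2)| := by
  have hlim : ∀ᶠ x in 𝓝 (0 : ℝ), C⁻¹ < sinc (x / 2) := by
    have hc : Continuous fun x : ℝ => sinc (x / 2) := by
      have := continuous_sinc
      fun_prop
    refine (hc.tendsto 0).eventually_const_lt ?_
    simpa using inv_lt_one_of_one_lt₀ hC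
  obtain ⟨δ, hδ, h⟩ := Metric.eventually_nhds_iff.1 hlim
  refine ⟨δ, hδ, fun x hx => ?_⟩
  have hs : C⁻¹ < sinc (x / 2) := h (by simpa using hx)
  have hC0 : 0 < C := by linarith
  have hpos : 0 < sinc (x / 2) := (inv_pos.2 hC0).trans hs
  rcases eq_or_ne x 0 with rfl | hx0
  · simp
  have heq : 2 * sin (x / 2) = x * sinc (x / 2) := by
    rw [sinc_of_ne_zero (by simpa using hx0)]
    field_simp
  rw [heq, abs_mul, abs_of_pos hpos]
  have : 1 ≤ C * sinc (x / 2) := by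
    rw [inv_lt_iff_one_lt_mul₀ hC0] at hs
    linarith
  nlinarith [abs_nonneg x]

theorem dist_circleMap {R : ℝ} (hR : 0 ≤ R) (c : ℂ) (s t : ℝ) :
    dist (circleMap c R s) (circleMap c R t) = R * |2 * sin ((s - t) / 2)| := by
  have h : circleMap c R s - circleMap c R t =
      R * Complex.exp (t * Complex.I) * (Complex.exp (Complex.I * ((s - t : ℝ) : ℂ)) - 1) := by
    simp only [circleMap]
    rw [mul_sub, mul_assoc, ← Complex.exp_add]
    push_cast
    ring_nf
  rw [dist_eq_norm, h, norm_mul, norm_mul, Complex.norm_exp_I_mul_ofReal_sub_one,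
    Complex.norm_exp_ofReal_mul_I]
  simp [abs_of_nonneg hR]

theorem circleMap_zero_arg {R : ℝ} {z : ℂ} (hz : ‖z‖ = R) : circleMap 0 R z.arg = z := by
  rw [circleMap_zero, ← hz, Complex.norm_mul_exp_arg_mul_I]

theorem arg_circleMap_zero {R θ : ℝ} (hR : 0 < R) (hθ : θ ∈ Ioc (-π) π) :
    (circleMap 0 R θ).arg = θ := by
  rw [circleMap_zero, Complex.arg_real_mul _ hR, Complex.arg_exp_mul_I,
    toIocMod_eq_self]
  convert hθ using 1
  ring_nf

theorem hausdorffMeasure_one_inter_sphere_le {R : ℝ} (hR : 0 < R) (S : Set ℂ) :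
    μH[1] (S ∩ sphere 0 R) ≤
      ENNReal.ofReal R * volume (circleMap 0 R ⁻¹' S ∩ Ioc (-π) π) := by
  have hsub : S ∩ sphere 0 R ⊆ circleMap 0 R '' (circleMap 0 R ⁻¹' S ∩ Ioc (-π) π) := by
    rintro z ⟨hzS, hz⟩
    have hz' := circleMap_zero_arg (mem_sphere_zero_iff_norm.1 hz)
    exact ⟨z.arg, ⟨by simpa [hz'] using hzS, Complex.arg_mem_Ioc z⟩, hz'⟩
  refine (measure_mono hsub).trans ?_
  have := (lipschitzWith_circleMap 0 R).hausdorffMeasure_image_le zero_le_one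
    (circleMap 0 R ⁻¹' S ∩ Ioc (-π) π)
  rwa [hausdorffMeasure_real, ENNReal.rpow_one, Real.nnabs_of_nonneg hR.le] at this

theorem le_mul_hausdorffMeasure_one_inter_sphere {R C : ℝ} (hR : 0 < R) (hC : 1 < C)
    {S : Set ℂ} (hS : MeasurableSet S) :
    volume (circleMap 0 R ⁻¹' S ∩ Ioc (-π) π) ≤
      ENNReal.ofReal (C / R) * μH[1] (S ∩ sphere 0 R) := by
  obtain ⟨δ, hδ, hsin⟩ := exists_pos_forall_abs_le_mul_abs_two_mul_sin_half hC
  let I : ℤ → Set ℝ := fun n => Ioc (n • δ) ((n + 1) • δ)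
  let P : ℤ → Set ℂ := fun n => S ∩ sphere 0 R ∩ Complex.arg ⁻¹' I n
  have hIu : ⋃ n, I n = univ := iUnion_Ioc_zsmul hδ
  have hId : Pairwise (Function.onFun Disjoint I) := pairwise_disjoint_Ioc_zsmul δ
  have hPm : ∀ n, MeasurableSet (P n) := fun n =>
    (hS.inter isClosed_sphere.measurableSet).inter (Complex.measurable_arg measurableSet_Ioc)
  have hPd : Pairwise (Function.onFun Disjoint P) := fun i j hij =>
    ((hId hij).preimage Complex.arg).mono inter_subset_right inter_subset_right
  have hPu : S ∩ sphere 0 R = ⋃ n, P n := by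
    simp only [P, ← inter_iUnion, ← preimage_iUnion, hIu, preimage_univ, inter_univ]
  have hle : ∀ n, volume (Complex.arg '' P n) ≤ ENNReal.ofReal (C / R) * μH[1] (P n) := by
    intro n
    have hL : LipschitzOnWith (C / R).toNNReal Complex.arg (P n) := by
      refine LipschitzOnWith.of_dist_le_mul fun z hz w hw => ?_
      have hz' := circleMap_zero_arg (mem_sphere_zero_iff_norm.1 hz.1.2)
      have hw' := circleMap_zero_arg (mem_sphere_zero_iff_norm.1 hw.1.2)
      have hlt : |z.arg - w.arg| < δ := by
        have h1 := hz.2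
        have h2 := hw.2
        simp only [I, mem_preimage, mem_Ioc, zsmul_eq_mul, Int.cast_add, Int.cast_one] at h1 h2
        rw [abs_lt]
        constructor <;> linarith [h1.1, h1.2, h2.1, h2.2]
      rw [Real.coe_toNNReal _ (by positivity)]
      nth_rw 2 [← hz', ← hw']
      rw [dist_circleMap hR.le, Real.dist_eq]
      calc |z.arg - w.arg| ≤ C * |2 * sin ((z.arg - w.arg) / 2)| := hsin _ hlt
        _ = _ := by field_simp
    have := hL.hausdorffMeasure_image_le zero_le_one
    rwa [hausdorffMeasure_real, ENNReal.rpow_one] at this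
  have hsub : circleMap 0 R ⁻¹' S ∩ Ioc (-π) π ⊆ ⋃ n, Complex.arg '' P n := by
    rintro θ ⟨hθS, hθ⟩
    rw [← image_iUnion, ← hPu]
    exact ⟨circleMap 0 R θ, ⟨hθS, circleMap_mem_sphere 0 hR.le θ⟩, arg_circleMap_zero hR hθ⟩
  calc volume (circleMap 0 R ⁻¹' S ∩ Ioc (-π) π)
      ≤ ∑' n, volume (Complex.arg '' P n) := (measure_mono hsub).trans (measure_iUnion_le _)
    _ ≤ ∑' n, ENNReal.ofReal (C / R) * μH[1] (P n) := ENNReal.tsum_le_tsum hle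
    _ = ENNReal.ofReal (C / R) * μH[1] (S ∩ sphere 0 R) := by
      rw [ENNReal.tsum_mul_left, hPu, measure_iUnion hPd hPm]

/-- The arclength measure on a circle centred at the origin, in the angular parametrization. -/
theorem hausdorffMeasure_one_restrict_sphere {R : ℝ} (hR : 0 < R) :
    (μH[1] : Measure ℂ).restrict (sphere 0 R) =
      ENNReal.ofReal R • (volume.restrict (Ioc (-π) π)).map (circleMap 0 R) := by
  ext S hS
  have hm : Measurable (circleMap 0 R) := (continuous_circleMap 0 R).measurable
  rw [Measure.restrict_apply hS, Measure.smul_apply, Measure.map_apply hm hS,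
    Measure.restrict_apply (hm hS), smul_eq_mul]
  refine le_antisymm (hausdorffMeasure_one_inter_sphere_le hR S) ?_
  set v := volume (circleMap 0 R ⁻¹' S ∩ Ioc (-π) π)
  set m := μH[1] (S ∩ sphere (0 : ℂ) R)
  have hvm : ∀ C : ℝ, 1 < C → ENNReal.ofReal R * v ≤ ENNReal.ofReal C * m := fun C hC => by
    have h := le_mul_hausdorffMeasure_one_inter_sphere hR hC hS
    calc ENNReal.ofReal R * v ≤ ENNReal.ofReal R * (ENNReal.ofReal (C / R) * m) := by gcongr
      _ = ENNReal.ofReal C * m := by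
        rw [← mul_assoc, ← ENNReal.ofReal_mul hR.le, mul_div_cancel₀ _ hR.ne']
  have hlim : Tendsto (fun C : ℝ => ENNReal.ofReal C * m) (𝓝[>] 1) (𝓝 (1 * m)) := by
    refine ENNReal.Tendsto.mul_const ?_ (Or.inl one_ne_zero)
    rw [← ENNReal.ofReal_one]
    exact (ENNReal.continuous_ofReal.tendsto 1).mono_left nhdsWithin_le_nhds
  simpa using ge_of_tendsto hlim (eventually_mem_nhdsWithin.mono hvm)

variable {V : Type*} [NormedAddCommGroup V] [InnerProductSpace ℝ V]

theorem inner_smul_circleMap_add_inner_smul_circleMap_mul_I (L : ℂ ≃ₗᵢ[ℝ] V) (a : V) (θ : ℝ) :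
    ⟪a, L (circleMap 0 1 θ)⟫ • L (circleMap 0 1 θ) +
      ⟪a, L (circleMap 0 1 θ * Complex.I)⟫ • L (circleMap 0 1 θ * Complex.I) = a := by
  obtain ⟨w, rfl⟩ := L.surjective a
  rw [L.inner_map_map, L.inner_map_map, ← map_smul, ← map_smul, ← map_add]
  congr 1
  have hc : circleMap 0 1 θ = ⟨cos θ, sin θ⟩ := by
    rw [circleMap_zero, Complex.exp_mul_I, ← Complex.ofReal_cos, ← Complex.ofReal_sin]
    apply Complex.ext <;> simp [-Complex.ofReal_cos, -Complex.ofReal_sin]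
  have hsq := sin_sq_add_cos_sq θ
  rw [hc]
  apply Complex.ext
  · simp [Complex.inner, -Complex.ofReal_cos, -Complex.ofReal_sin]
    linear_combination w.re * hsq
  · simp [Complex.inner, -Complex.ofReal_cos, -Complex.ofReal_sin]
    linear_combination w.im * hsq

variable [MeasurableSpace V] [BorelSpace V]

theorem hausdorffMeasure_one_restrict_sphere_of_isometry (L : ℂ ≃ₗᵢ[ℝ] V) (x₀ : V) {R : ℝ}
    (hR : 0 < R) :
    (μH[1] : Measure V).restrict (sphere x₀ R) = ENNReal.ofReal R •
      (volume.restrict (Ioc (-π) π)).map (fun θ => x₀ + L (circleMap 0 R θ)) := by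
  let e : ℂ ≃ᵢ V := L.toIsometryEquiv.trans (IsometryEquiv.addLeft x₀)
  have he : ∀ z, e z = x₀ + L z := fun z => rfl
  have hpre : e ⁻¹' sphere x₀ R = sphere 0 R := by
    ext z
    rw [mem_preimage, he]
    simp
  have hmp := (e.measurePreserving_hausdorffMeasure 1).restrict_preimage
    (isClosed_sphere (x := x₀) (ε := R)).measurableSet
  rw [← hmp.map_eq, hpre, hausdorffMeasure_one_restrict_sphere hR, Measure.map_smul,
    Measure.map_map e.continuous.measurable (continuous_circleMap 0 R).measurable]
  rfl

theorem integrableOn_sphere_of_continuousOn [FiniteDimensional ℝ V] (L : ℂ ≃ₗᵢ[ℝ] V) {x₀ : V} {R : ℝ} (hR : 0 < R)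
    {f : V → ℝ} (hf : ContinuousOn f (sphere x₀ R)) : IntegrableOn f (sphere x₀ R) μH[1] := by
  have hfin : μH[1] (sphere x₀ R) < ⊤ := by
    rw [← Measure.restrict_apply_univ, hausdorffMeasure_one_restrict_sphere_of_isometry L x₀ hR]
    exact ENNReal.mul_lt_top ENNReal.ofReal_lt_top (measure_lt_top _ _)
  obtain ⟨C, hC⟩ := (isCompact_sphere x₀ R).exists_bound_of_continuousOn hf
  exact IntegrableOn.of_bound hfin
    (hf.aestronglyMeasurable isClosed_sphere.measurableSet) C
    ((ae_restrict_iff' isClosed_sphere.measurableSet).2 (ae_of_all _ hC))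

/-- Arclength integrals over a circle in a Euclidean plane, in the angular parametrization. -/
theorem setIntegral_sphere [FiniteDimensional ℝ V] (L : ℂ ≃ₗᵢ[ℝ] V) {x₀ : V} {R : ℝ} (hR : 0 < R)
    {f : V → ℝ} (hf : ContinuousOn f (sphere x₀ R)) :
    ∫ z in sphere x₀ R, f z ∂μH[1] =
      ∫ θ in Ioc (-π) π, R * f (x₀ + L (circleMap 0 R θ)) := by
  have hfm := (integrableOn_sphere_of_continuousOn L hR hf).aestronglyMeasurable
  rw [hausdorffMeasure_one_restrict_sphere_of_isometry L x₀ hR] at hfm ⊢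
  have hc : Continuous fun θ => x₀ + L (circleMap 0 R θ) := by
    have := continuous_circleMap 0 R
    fun_prop
  rw [integral_smul_measure, integral_map hc.aemeasurable, integral_const_mul,
    ENNReal.toReal_ofReal hR.le, smul_eq_mul]
  exact hfm.mono_ac (Measure.absolutelyContinuous_smul (by simpa using hR))

/-- Polar coordinates on a disc in a Euclidean plane. -/
theorem setIntegral_ball [FiniteDimensional ℝ V] (L : ℂ ≃ₗᵢ[ℝ] V) (x₀ : V) (R : ℝ) (f : V → ℝ) :
    ∫ z in ball x₀ R, f z = ∫ p in Ioo 0 R ×ˢ Ioo (-π) π,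
      p.1 * f (x₀ + L (circleMap 0 p.1 p.2)) := by
  have htrans : ∫ z in ball x₀ R, f z = ∫ w in ball (0 : ℂ) R, f (x₀ + L w) := by
    have hmp : MeasurePreserving (fun w => x₀ + L w) :=
      (measurePreserving_add_left volume x₀).comp L.measurePreserving
    have hemb : MeasurableEmbedding fun w => x₀ + L w :=
      (L.toHomeomorph.trans (Homeomorph.addLeft x₀)).measurableEmbedding
    rw [← hmp.setIntegral_preimage_emb hemb]
    congr 2
    ext z
    simp
  rw [htrans, ← integral_indicator measurableSet_ball, ← Complex.integral_comp_polarCoord_symm,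
    show polarCoord.target = Ioi 0 ×ˢ Ioo (-π) π from rfl]
  have hsymm : ∀ p : ℝ × ℝ, Complex.polarCoord.symm p = circleMap 0 p.1 p.2 := fun p => by
    rw [Complex.polarCoord_symm_apply, circleMap_zero, Complex.exp_mul_I]
    simp
  have hset : Ioo 0 R ×ˢ Ioo (-π) π = Ioi 0 ×ˢ Ioo (-π) π ∩ {p : ℝ × ℝ | p.1 < R} := by
    ext p
    simp only [mem_prod, mem_Ioo, mem_inter_iff, mem_Ioi, mem_ofPred_eq]
    tauto
  rw [hset, ← setIntegral_indicator (measurableSet_lt measurable_fst measurable_const)]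
  refine setIntegral_congr_fun (measurableSet_Ioi.prod measurableSet_Ioo) fun p hp => ?_
  have hp0 : 0 < p.1 := hp.1
  by_cases h : p.1 < R <;> simp [hsymm, indicator, h, abs_of_pos hp0]

/-- The divergence theorem on a disc for the vector field `z ↦ h z • (z - z₁)`. -/
theorem setIntegral_ball_divergence_smul_sub [FiniteDimensional ℝ V] (L : ℂ ≃ₗᵢ[ℝ] V)
    (x₀ z₁ : V) {R : ℝ} (hR : 0 < R) {U : Set V} (hBU : closedBall x₀ R ⊆ U)
    {h : V → ℝ} {h' : V → V →L[ℝ] ℝ} (hh : ∀ z ∈ U, HasFDerivAt h (h' z) z)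
    (hh' : ContinuousOn h' U) :
    ∫ z in ball x₀ R, (2 * h z + h' z (z - z₁)) =
      ∫ z in sphere x₀ R, ⟪z - z₁, R⁻¹ • (z - x₀)⟫ * h z ∂μH[1] := by
  have hcont : ContinuousOn h U := fun z hz => (hh z hz).continuousAt.continuousWithinAt
  let e : ℝ → V := fun θ => L (circleMap 0 1 θ)
  let n : ℝ → V := fun θ => L (circleMap 0 1 θ * Complex.I)
  have hee : ∀ θ, ⟪e θ, e θ⟫ = 1 := fun θ => by
    rw [real_inner_self_eq_norm_sq, L.norm_map, norm_circleMap_zero]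
    simp
  have he : ∀ θ, HasDerivAt e (n θ) θ := fun θ =>
    L.toContinuousLinearEquiv.hasFDerivAt.comp_hasDerivAt θ (hasDerivAt_circleMap 0 1 θ)
  have hn : ∀ θ, HasDerivAt n (-e θ) θ := fun θ => by
    have := L.toContinuousLinearEquiv.hasFDerivAt.comp_hasDerivAt θ
      ((hasDerivAt_circleMap 0 1 θ).mul_const Complex.I)
    refine this.congr_deriv ?_
    simp [e, mul_assoc]
  let a : V := x₀ - z₁
  let α : ℝ → ℝ := fun θ => ⟪a, e θ⟫
  let β : ℝ → ℝ := fun θ => ⟪a, n θ⟫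
  have ha : ∀ θ, α θ • e θ + β θ • n θ = a := fun θ =>
    inner_smul_circleMap_add_inner_smul_circleMap_mul_I L a θ
  have hα : ∀ θ, HasDerivAt α (β θ) θ := fun θ =>
    (innerSL ℝ a).hasFDerivAt.comp_hasDerivAt θ (he θ)
  have hβ : ∀ θ, HasDerivAt β (-α θ) θ := fun θ => by
    simpa [α, β, Function.comp_def] using (innerSL ℝ a).hasFDerivAt.comp_hasDerivAt θ (hn θ)
  let P : ℝ × ℝ → V := fun p => x₀ + p.1 • e p.2
  have hPL : ∀ r θ, x₀ + L (circleMap 0 r θ) = P (r, θ) := fun r θ => by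
    simp only [P, e, ← map_smul, circleMap_zero]
    simp
  let fst := ContinuousLinearMap.fst ℝ ℝ ℝ
  let snd := ContinuousLinearMap.snd ℝ ℝ ℝ
  let P' : ℝ × ℝ → ℝ × ℝ →L[ℝ] V := fun p => p.1 • snd.smulRight (n p.2) + fst.smulRight (e p.2)
  have hfst : ∀ p : ℝ × ℝ, HasFDerivAt (fun p : ℝ × ℝ => p.1) fst p := fun p => hasFDerivAt_fst
  have hsnd : ∀ p : ℝ × ℝ, HasFDerivAt (fun p : ℝ × ℝ => p.2) snd p := fun p => hasFDerivAt_snd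
  have hP : ∀ p, HasFDerivAt P (P' p) p := fun p => by
    have h1 : HasFDerivAt (fun p : ℝ × ℝ => e p.2) (snd.smulRight (n p.2)) p := by
      refine ((he p.2).hasFDerivAt.comp p (hsnd p)).congr_fderiv ?_
      ext <;> simp [snd]
    exact ((hfst p).smul h1).const_add x₀
  have hα₂ : ∀ p : ℝ × ℝ, HasFDerivAt (fun p : ℝ × ℝ => α p.2) (β p.2 • snd) p := fun p =>
    (hα p.2).comp_hasFDerivAt p (hsnd p)
  have hβ₂ : ∀ p : ℝ × ℝ, HasFDerivAt (fun p : ℝ × ℝ => β p.2) (-α p.2 • snd) p := fun p =>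
    (hβ p.2).comp_hasFDerivAt p (hsnd p)
  let F : ℝ × ℝ → ℝ := fun p => p.1 * (p.1 + α p.2) * h (P p)
  let G : ℝ × ℝ → ℝ := fun p => β p.2 * h (P p)
  let F' : ℝ × ℝ → ℝ × ℝ →L[ℝ] ℝ := fun p =>
    (p.1 * (p.1 + α p.2)) • (h' (P p)).comp (P' p) +
      h (P p) • (p.1 • (fst + β p.2 • snd) + (p.1 + α p.2) • fst)
  let G' : ℝ × ℝ → ℝ × ℝ →L[ℝ] ℝ := fun p =>
    β p.2 • (h' (P p)).comp (P' p) + h (P p) • (-α p.2 • snd)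
  have hF : ∀ p, P p ∈ U → HasFDerivAt F (F' p) p := fun p hp =>
    ((hfst p).mul ((hfst p).add (hα₂ p))).mul ((hh _ hp).comp p (hP p))
  have hG : ∀ p, P p ∈ U → HasFDerivAt G (G' p) p := fun p hp =>
    (hβ₂ p).mul ((hh _ hp).comp p (hP p))
  have hPU : ∀ p ∈ Icc ((0 : ℝ), -π) (R, π), P p ∈ U := fun p hp => by
    obtain ⟨⟨h0, -⟩, h1, -⟩ := hp
    refine hBU ?_
    rw [mem_closedBall_iff_norm, ← hPL]
    simpa [abs_of_nonneg (show 0 ≤ p.1 from h0)] using h1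
  have hdiv : ∀ p, F' p (1, 0) + G' p (0, 1) =
      p.1 * (2 * h (P p) + h' (P p) (P p - z₁)) := fun p => by
    have hz : P p - z₁ = p.1 • e p.2 + (α p.2 • e p.2 + β p.2 • n p.2) := by
      rw [ha]
      simp only [P, a]
      abel
    rw [hz]
    simp [F', G', P', fst, snd]
    ring
  have hPc : Continuous P := continuous_iff_continuousAt.2 fun p => (hP p).continuousAt
  have hint : IntegrableOn (fun p => F' p (1, 0) + G' p (0, 1)) (Icc ((0 : ℝ), -π) (R, π)) := by
    simp only [hdiv]
    refine ContinuousOn.integrableOn_compact isCompact_Icc ?_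
    have hhP := hcont.comp hPc.continuousOn hPU
    have hh'P := hh'.comp hPc.continuousOn hPU
    exact continuousOn_fst.mul ((continuousOn_const.mul hhP).add
      (hh'P.clm_apply (hPc.continuousOn.sub continuousOn_const)))
  have hmem : ∀ p ∈ Ioo (0 : ℝ) R ×ˢ Ioo (-π) π, p ∈ Icc ((0 : ℝ), -π) (R, π) := fun p hp =>
    ⟨⟨hp.1.1.le, hp.2.1.le⟩, hp.1.2.le, hp.2.2.le⟩
  have hstokes := integral_divergence_prod_Icc_of_hasFDerivAt_of_le F G F' G' (0, -π) (R, π)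
    ⟨hR.le, by simp [pi_pos.le]⟩
    (fun p hp => (hF p (hPU p hp)).continuousAt.continuousWithinAt)
    (fun p hp => (hG p (hPU p hp)).continuousAt.continuousWithinAt)
    (fun p hp => hF p (hPU p (hmem p hp))) (fun p hp => hG p (hPU p (hmem p hp))) hint
  have hGper : ∀ r, G (r, π) = G (r, -π) := fun r => by
    have : circleMap 0 1 (-π) = circleMap 0 1 π := by
      rw [← periodic_circleMap 0 1 (-π)]
      ring_nf
    simp [G, P, β, e, n, this]
  have hF0 : ∀ θ, F (0, θ) = 0 := fun θ => by simp [F]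
  simp only [hGper, hF0, sub_self, zero_add, intervalIntegral.integral_zero, sub_zero, hdiv]
    at hstokes
  rw [setIntegral_ball L]
  simp only [hPL]
  have hIoo : Ioo (0 : ℝ) R ×ˢ Ioo (-π) π =ᵐ[volume] Icc ((0 : ℝ), -π) (R, π) := by
    rw [← Icc_prod_Icc, Measure.volume_eq_prod]
    exact Measure.set_prod_ae_eq Ioo_ae_eq_Icc Ioo_ae_eq_Icc
  rw [setIntegral_congr_set hIoo, hstokes, setIntegral_sphere L hR,
    intervalIntegral.integral_of_le (by linarith [pi_pos])]
  · congr 1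
    ext θ
    rw [hPL]
    have h1 : P (R, θ) - x₀ = R • e θ := by simp [P]
    have h2 : P (R, θ) - z₁ = R • e θ + a := by
      simp only [P, a]
      abel
    rw [h1, h2, inv_smul_smul₀ hR.ne', inner_add_left, real_inner_smul_left, hee]
    simp only [F, α]
    ring
  · refine ContinuousOn.mul ?_ (hcont.mono (sphere_subset_closedBall.trans hBU))
    fun_prop
end

/-- Wolansky-type Pohozaev identity on a ball `B(x₀,R) ⊂ ℝ²`:
`∫_B div((z-z₁) K e^u) log K - ∫_{∂B} ⟨z-z₁, ν⟩ K e^u log K dσ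
  = ∫_B ⟨z-z₁, ∇u⟩ (K - K(z₁)) e^u + 2 ∫_B (K - K(z₁)) e^u
    + ∫_{∂B} ⟨z-z₁, ν⟩ (K(z₁) - K) e^u dσ`,
where `div((z-z₁) K e^u) = 2 K e^u + ⟨z-z₁, ∇K⟩ e^u + K e^u ⟨z-z₁, ∇u⟩`,
`ν(z) = (z-x₀)/R`, and `dσ` is the one-dimensional Hausdorff measure on `∂B`. -/
theorem wolansky_pohozaev_identity
    (x₀ z₁ : EuclideanSpace ℝ (Fin 2)) (R : ℝ) (hR : 0 < R)
    (u K : EuclideanSpace ℝ (Fin 2) → ℝ)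
    (U : Set (EuclideanSpace ℝ (Fin 2))) (hU : IsOpen U)
    (hBU : closedBall x₀ R ⊆ U)
    (hu : ContDiffOn ℝ 1 u U) (hK : ContDiffOn ℝ 1 K U)
    (hKpos : ∀ z ∈ U, 0 < K z) :
    (∫ z in ball x₀ R,
        (2 * K z * exp (u z) + ⟪z - z₁, gradient K z⟫ * exp (u z)
          + K z * exp (u z) * ⟪z - z₁, gradient u z⟫) * log (K z))
      - (∫ z in sphere x₀ R,
          ⟪z - z₁, R⁻¹ • (z - x₀)⟫ * (K z * exp (u z) * log (K z)) ∂μH[1])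
    = (∫ z in ball x₀ R, ⟪z - z₁, gradient u z⟫ * ((K z - K z₁) * exp (u z)))
      + 2 * (∫ z in ball x₀ R, (K z - K z₁) * exp (u z))
      + ∫ z in sphere x₀ R,
          ⟪z - z₁, R⁻¹ • (z - x₀)⟫ * ((K z₁ - K z) * exp (u z)) ∂μH[1] := by
  let L : ℂ ≃ₗᵢ[ℝ] EuclideanSpace ℝ (Fin 2) := Complex.orthonormalBasisOneI.repr
  let Φ : ℝ → ℝ := fun k => k * log k - k + K z₁
  let h : EuclideanSpace ℝ (Fin 2) → ℝ := fun z => Φ (K z) * exp (u z)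
  let h' : EuclideanSpace ℝ (Fin 2) → EuclideanSpace ℝ (Fin 2) →L[ℝ] ℝ := fun z =>
    Φ (K z) • exp (u z) • fderiv ℝ u z + exp (u z) • log (K z) • fderiv ℝ K z
  have hΦ : ∀ k : ℝ, k ≠ 0 → HasDerivAt Φ (log k) k := fun k hk => by
    refine (((hasDerivAt_mul_log hk).sub (hasDerivAt_id k)).add_const (K z₁)).congr_deriv ?_
    ring
  have hdu : ∀ z ∈ U, HasFDerivAt u (fderiv ℝ u z) z := fun z hz =>
    ((hu.differentiableOn one_ne_zero).differentiableAt (hU.mem_nhds hz)).hasFDerivAt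
  have hdK : ∀ z ∈ U, HasFDerivAt K (fderiv ℝ K z) z := fun z hz =>
    ((hK.differentiableOn one_ne_zero).differentiableAt (hU.mem_nhds hz)).hasFDerivAt
  have hh : ∀ z ∈ U, HasFDerivAt h (h' z) z := fun z hz =>
    ((hΦ (K z) (hKpos z hz).ne').comp_hasFDerivAt z (hdK z hz)).mul (hdu z hz).exp
  have hcu' : ContinuousOn (fderiv ℝ u) U := hu.continuousOn_fderiv_of_isOpen hU le_rfl
  have hcK' : ContinuousOn (fderiv ℝ K) U := hK.continuousOn_fderiv_of_isOpen hU le_rfl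
  have hcu : ContinuousOn u U := hu.continuousOn
  have hcK : ContinuousOn K U := hK.continuousOn
  have hclog : ContinuousOn (fun z => log (K z)) U := hcK.log fun z hz => (hKpos z hz).ne'
  have hcexp : ContinuousOn (fun z => exp (u z)) U := hcu.rexp
  have hcΦ : ContinuousOn (fun z => Φ (K z)) U := by fun_prop
  have hcsub : ContinuousOn (fun z => z - z₁) U := by fun_prop
  have hcdu : ContinuousOn (fun z => fderiv ℝ u z (z - z₁)) U := hcu'.clm_apply hcsub
  have hcdK : ContinuousOn (fun z => fderiv ℝ K z (z - z₁)) U := hcK'.clm_apply hcsub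
  have hch' : ContinuousOn h' U := by fun_prop
  have hmain := setIntegral_ball_divergence_smul_sub L x₀ z₁ hR hBU hh hch'
  have hgrad : ∀ (f : EuclideanSpace ℝ (Fin 2) → ℝ) (z v : EuclideanSpace ℝ (Fin 2)),
      ⟪v, gradient f z⟫ = fderiv ℝ f z v := fun f z v => by
    rw [real_inner_comm, gradient, InnerProductSpace.toDual_symm_apply]
  simp only [hgrad]
  have hball : ∀ f : EuclideanSpace ℝ (Fin 2) → ℝ, ContinuousOn f U →
      IntegrableOn f (ball x₀ R) := fun f hf =>
    ((hf.mono hBU).integrableOn_compact (isCompact_closedBall x₀ R)).mono_set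
      ball_subset_closedBall
  have hsphere : ∀ f : EuclideanSpace ℝ (Fin 2) → ℝ, ContinuousOn f U →
      IntegrableOn f (sphere x₀ R) μH[1] := fun f hf =>
    integrableOn_sphere_of_continuousOn L hR (hf.mono (sphere_subset_closedBall.trans hBU))
  have hB : ∫ z in ball x₀ R, (2 * h z + h' z (z - z₁)) =
      (∫ z in ball x₀ R, (2 * K z * exp (u z) + fderiv ℝ K z (z - z₁) * exp (u z)
          + K z * exp (u z) * fderiv ℝ u z (z - z₁)) * log (K z))
        - (∫ z in ball x₀ R, fderiv ℝ u z (z - z₁) * ((K z - K z₁) * exp (u z)))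
        - 2 * (∫ z in ball x₀ R, (K z - K z₁) * exp (u z)) := by
    rw [← integral_const_mul, ← integral_sub (hball _ (by fun_prop)) (hball _ (by fun_prop)),
      ← integral_sub (hball _ (by fun_prop)) (hball _ (by fun_prop))]
    congr 1
    ext z
    simp [h, h', Φ]
    ring
  have hS : ∫ z in sphere x₀ R, ⟪z - z₁, R⁻¹ • (z - x₀)⟫ * h z ∂μH[1] =
      (∫ z in sphere x₀ R,
          ⟪z - z₁, R⁻¹ • (z - x₀)⟫ * (K z * exp (u z) * log (K z)) ∂μH[1])
        + ∫ z in sphere x₀ R,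
          ⟪z - z₁, R⁻¹ • (z - x₀)⟫ * ((K z₁ - K z) * exp (u z)) ∂μH[1] := by
    rw [← integral_add (hsphere _ (by fun_prop)) (hsphere _ (by fun_prop))]
    congr 1
    ext z
    simp only [h, Φ]
    ring
  rw [hB, hS] at hmain
  linarith
end

section
/- (Brezis–Merle interior estimate.) Let Ω ⊂ ℝ² be a bounded open set, K ⊂ Ω a compact set, and 0 < a ≤ b, m ∈ ℝ. There exists a constant c = c(a, b, m, K, Ω) such that for every pair (u, V) where u is C² on Ω, V : Ω → ℝ satisfies a ≤ V ≤ b, −Δu = V e^{u} in Ω, and inf_Ω u ≥ m, one has sup_K u ≤ c. -/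
open MeasureTheory Metric Real

/-- The Laplacian on `ℝ²`: `Δu = ∂²u/∂x₁² + ∂²u/∂x₂²`. -/
noncomputable def lap (u : EuclideanSpace ℝ (Fin 2) → ℝ) (x : EuclideanSpace ℝ (Fin 2)) : ℝ :=
  ∑ i : Fin 2,
    fderiv ℝ (fun y => fderiv ℝ u y (EuclideanSpace.single i 1)) x (EuclideanSpace.single i 1)

theorem le_of_hasDerivAt_nonneg {f f' : ℝ → ℝ} {s t : ℝ} (hst : s ≤ t)
    (hc : ContinuousOn f (Set.Icc s t)) (hd : ∀ x ∈ Set.Ioo s t, HasDerivAt f (f' x) x)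
    (h : ∀ x ∈ Set.Ioo s t, 0 ≤ f' x) : f s ≤ f t := by
  refine monotoneOn_of_deriv_nonneg (convex_Icc s t) hc ?_ ?_ (Set.left_mem_Icc.2 hst)
    (Set.right_mem_Icc.2 hst) hst
  · rw [interior_Icc]
    exact fun x hx => (hd x hx).differentiableAt.differentiableWithinAt
  · rw [interior_Icc]
    exact fun x hx => (hd x hx).deriv ▸ h x hx

/-- A function `g` on `[0, T)` together with its flux `p = -r dg/dr`, where the flux has derivative
`r F` with `F ≥ a e^g`. -/
structure IsRadialProfile (a T : ℝ) (g p F : ℝ → ℝ) : Prop where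
  continuousOn : ContinuousOn g (Set.Ico 0 T)
  continuousOn_flux : ContinuousOn p (Set.Ico 0 T)
  flux_zero : p 0 = 0
  hasDerivAt : ∀ r ∈ Set.Ioo 0 T, HasDerivAt g (-p r / r) r
  hasDerivAt_flux : ∀ r ∈ Set.Ioo 0 T, HasDerivAt p (r * F r) r
  mul_exp_le : ∀ r ∈ Set.Ioo 0 T, a * exp (g r) ≤ F r

namespace IsRadialProfile

variable {a T : ℝ} {g p F : ℝ → ℝ}

theorem flux_le (h : IsRadialProfile a T g p F) (ha : 0 < a) {s t : ℝ} (hs : 0 ≤ s)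
    (hst : s ≤ t) (ht : t < T) : p s ≤ p t := by
  refine le_of_hasDerivAt_nonneg (f' := fun r => r * F r) hst
    (h.continuousOn_flux.mono fun x hx => ⟨hs.trans hx.1, hx.2.trans_lt ht⟩)
    (fun x hx => h.hasDerivAt_flux x ⟨hs.trans_lt hx.1, hx.2.trans ht⟩) fun x hx => ?_
  have hx0 : 0 < x := hs.trans_lt hx.1
  have := h.mul_exp_le x ⟨hx0, hx.2.trans ht⟩
  have : 0 < F x := lt_of_lt_of_le (by positivity) this
  positivity

theorem flux_nonneg (h : IsRadialProfile a T g p F) (ha : 0 < a) {s : ℝ} (hs : 0 ≤ s)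
    (hsT : s < T) : 0 ≤ p s :=
  h.flux_zero ▸ h.flux_le ha le_rfl hs hsT

theorem flux_mul_log_le (h : IsRadialProfile a T g p F) (ha : 0 < a) {s t : ℝ} (hs : 0 < s)
    (hst : s ≤ t) (ht : t < T) : g t + p s * (log t - log s) ≤ g s := by
  have key := le_of_hasDerivAt_nonneg (f := fun r => -(g r) - p s * log r)
    (f' := fun r => -(-p r / r) - p s * r⁻¹) hst ?_ ?_ ?_
  · linarith
  · refine ContinuousOn.sub (h.continuousOn.mono fun x hx =>
      ⟨hs.le.trans hx.1, hx.2.trans_lt ht⟩).neg (continuousOn_const.mul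
      (continuousOn_log.mono fun x hx => (hs.trans_le hx.1).ne'))
  · intro x hx
    have hx0 : 0 < x := hs.trans hx.1
    exact (h.hasDerivAt x ⟨hx0, hx.2.trans ht⟩).neg.sub ((hasDerivAt_log hx0.ne').const_mul _)
  · intro x hx
    have hx0 : 0 < x := hs.trans hx.1
    have := h.flux_le ha hs.le hx.1.le (hx.2.trans ht)
    have e : -(-p x / x) - p s * x⁻¹ = (p x - p s) / x := by field_simp
    rw [e]
    exact div_nonneg (by linarith) hx0.le

theorem le_flux_mul_log (h : IsRadialProfile a T g p F) (ha : 0 < a) {s t : ℝ} (hs : 0 < s)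
    (hst : s ≤ t) (ht : t < T) : g s ≤ g t + p t * (log t - log s) := by
  have key := le_of_hasDerivAt_nonneg (f := fun r => g r + p t * log r)
    (f' := fun r => -p r / r + p t * r⁻¹) hst ?_ ?_ ?_
  · linarith
  · refine ContinuousOn.add (h.continuousOn.mono fun x hx =>
      ⟨hs.le.trans hx.1, hx.2.trans_lt ht⟩) (continuousOn_const.mul
      (continuousOn_log.mono fun x hx => (hs.trans_le hx.1).ne'))
  · intro x hx
    have hx0 : 0 < x := hs.trans hx.1
    exact (h.hasDerivAt x ⟨hx0, hx.2.trans ht⟩).add ((hasDerivAt_log hx0.ne').const_mul _)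
  · intro x hx
    have hx0 : 0 < x := hs.trans hx.1
    have := h.flux_le ha hx0.le hx.2.le ht
    have e : -p x / x + p t * x⁻¹ = (p t - p x) / x := by field_simp; ring
    rw [e]
    exact div_nonneg (by linarith) hx0.le

theorem exists_flux_le {R : ℝ} (m : ℝ) (ha : 0 < a) (hR : 0 < R) (hRT : 4 * R < T) :
    ∃ P : ℝ, ∀ g p F, IsRadialProfile a T g p F → (∀ r ∈ Set.Ico 0 T, m ≤ g r) → p R ≤ P := by
  have hl : 0 < log 2 := log_pos one_lt_two
  set c : ℝ := log 2 * (a * R * exp m) * R with hc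
  have hc0 : 0 < c := by positivity
  refine ⟨-log c / log 2, fun g p F h hm => ?_⟩
  have key := le_of_hasDerivAt_nonneg
    (f := fun r => -exp (-(p r) * log 2) - log 2 * (a * R * exp m) * r)
    (f' := fun r => -(exp (-(p r) * log 2) * (-(r * F r) * log 2)) - log 2 * (a * R * exp m) * 1)
    (show R ≤ 2 * R by linarith) ?_ ?_ ?_
  · have h1 : c ≤ exp (-(p R) * log 2) := by
      have := exp_pos (-(p (2 * R)) * log 2)
      rw [hc]
      linarith
    have h2 := log_le_log hc0 h1
    rw [log_exp] at h2
    rw [le_div_iff₀ hl]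
    linarith
  · have := h.continuousOn_flux.mono (t := Set.Icc R (2 * R))
      fun x hx => ⟨hR.le.trans hx.1, hx.2.trans_lt (by linarith)⟩
    fun_prop
  · intro x hx
    have := h.hasDerivAt_flux x ⟨hR.trans hx.1, hx.2.trans (by linarith)⟩
    exact ((this.neg.mul_const _).exp.neg).sub ((hasDerivAt_id x).const_mul _)
  · intro x hx
    have hx0 : 0 < x := hR.trans hx.1
    have hxT : x < T := hx.2.trans (by linarith)
    have h1 := h.flux_mul_log_le ha hx0 (show x ≤ 4 * R by linarith [hx.2]) hRT
    have h2 := hm (4 * R) ⟨by linarith, hRT⟩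
    have h3 : log 2 ≤ log (4 * R) - log x := by
      rw [← log_div (by positivity) hx0.ne']
      apply log_le_log two_pos
      rw [le_div_iff₀ hx0]
      linarith [hx.2]
    have h4 := mul_le_mul_of_nonneg_left h3 (h.flux_nonneg ha hx0.le hxT)
    have h5 : exp m * exp (p x * log 2) ≤ exp (g x) := by
      rw [← exp_add, exp_le_exp]
      linarith
    have h6 : a * (exp m * exp (p x * log 2)) ≤ F x :=
      (mul_le_mul_of_nonneg_left h5 ha.le).trans (h.mul_exp_le x ⟨hx0, hxT⟩)
    have h7 : R * (a * (exp m * exp (p x * log 2))) ≤ x * F x :=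
      mul_le_mul hx.1.le h6 (by positivity) hx0.le
    have h8 := mul_le_mul_of_nonneg_left h7 (exp_pos (-(p x) * log 2)).le
    have h9 : exp (-(p x) * log 2) * exp (p x * log 2) = 1 := by
      rw [← exp_add]; simp
    have h10 : exp (-(p x) * log 2) * (R * (a * (exp m * exp (p x * log 2)))) = a * R * exp m := by
      linear_combination R * a * exp m * h9
    rw [h10] at h8
    nlinarith

theorem exists_flux_le_two_sub {R : ℝ} (m : ℝ) (ha : 0 < a) (hR : 0 < R) (hRT : 4 * R < T) :
    ∃ r ∈ Set.Ioc 0 R, ∃ ε > 0, ∀ g p F, IsRadialProfile a T g p F →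
      (∀ r ∈ Set.Ico 0 T, m ≤ g r) → p r ≤ 2 - ε := by
  obtain ⟨P, hP⟩ := exists_flux_le m ha hR hRT
  set c : ℝ := a * exp (m - 1) * R ^ 2 with hc
  have hc0 : 0 < c := by positivity
  set l : ℝ := max 1 (P / c)
  have hl1 : 1 ≤ l := le_max_left _ _
  have hl0 : 0 < l := by linarith
  have hlP : P ≤ c * l := by
    have := le_max_right 1 (P / c)
    rwa [div_le_iff₀' hc0] at this
  have hr0 : 0 < R * exp (-l) := by positivity
  have hrR : R * exp (-l) ≤ R := by
    have : exp (-l) ≤ 1 := exp_le_one_iff.2 (by linarith)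
    nlinarith
  have hlogr : log (R * exp (-l)) = log R - l := by
    rw [log_mul hR.ne' (exp_pos _).ne', log_exp]; ring
  refine ⟨R * exp (-l), ⟨hr0, hrR⟩, l⁻¹, by positivity, fun g p F h hm => ?_⟩
  by_contra! hlt
  set r := R * exp (-l)
  have hε1 : l⁻¹ ≤ 1 := inv_le_one_of_one_le₀ hl1
  have key := le_of_hasDerivAt_nonneg (f := fun x => p x - c * log x)
    (f' := fun x => x * F x - c * x⁻¹) hrR ?_ ?_ ?_
  · simp only [hlogr] at key
    have := hP g p F h hm
    linarith
  · exact (h.continuousOn_flux.mono fun x hx => ⟨hr0.le.trans hx.1, hx.2.trans_lt (by linarith)⟩).sub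
      (continuousOn_const.mul (continuousOn_log.mono fun x hx => (hr0.trans_le hx.1).ne'))
  · intro x hx
    have hx0 : 0 < x := hr0.trans hx.1
    exact (h.hasDerivAt_flux x ⟨hx0, hx.2.trans (by linarith)⟩).sub
      ((hasDerivAt_log hx0.ne').const_mul _)
  · intro x hx
    have hx0 : 0 < x := hr0.trans hx.1
    have hxT : x < T := hx.2.trans (by linarith)
    have h1 := h.flux_mul_log_le ha hx0 hx.2.le (by linarith)
    have h2 := hm R ⟨hR.le, by linarith⟩
    have h3 := h.flux_le ha hr0.le hx.1.le hxT
    have hlogx : log x ≤ log R := log_le_log hx0 hx.2.le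
    have hlogx' : log R - l ≤ log x := hlogr ▸ log_le_log hr0 hx.1.le
    have h4 : (2 - l⁻¹) * (log R - log x) ≤ p x * (log R - log x) :=
      mul_le_mul_of_nonneg_right (by linarith) (by linarith)
    have h5 : l⁻¹ * (log R - log x) ≤ 1 := by
      rw [inv_mul_le_iff₀ hl0]; linarith
    have h6 : exp (m - 1) * (R ^ 2 / x ^ 2) ≤ exp (g x) := by
      have : R ^ 2 / x ^ 2 = exp (2 * (log R - log x)) := by
        rw [← log_div hR.ne' hx0.ne', ← div_pow, mul_comm, exp_mul, exp_log (by positivity)]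
        norm_cast
      rw [this, ← exp_add, exp_le_exp]
      linarith
    have h7 := (mul_le_mul_of_nonneg_left h6 ha.le).trans (h.mul_exp_le x ⟨hx0, hxT⟩)
    have h8 := mul_le_mul_of_nonneg_left h7 hx0.le
    have h9 : x * (a * (exp (m - 1) * (R ^ 2 / x ^ 2))) = c * x⁻¹ := by
      rw [hc]; field_simp
    linarith

theorem apply_zero_add_log_le (h : IsRadialProfile a T g p F) (ha : 0 < a) {b d ε : ℝ}
    (hd : 0 < d) (hdT : d < T) (hε : 0 < ε) (hpd : p d ≤ 2 - ε)
    (hF : ∀ r ∈ Set.Ioo 0 d, F r ≤ 4 * b * exp (g 0)) :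
    g 0 + 2 * log d ≤ max 0 (2 * (b + log (4 / a)) / ε) := by
  set t : ℝ := exp (-(g 0) / 2) with ht
  have ht0 : 0 < t := exp_pos _
  have hlogt : log t = -(g 0) / 2 := log_exp _
  rcases le_total d t with hdt | htd
  · have := log_le_log hd hdt
    exact le_max_of_le_left (by linarith)
  refine le_max_of_le_right ?_
  have hflux : ∀ s ∈ Set.Icc 0 d, p s ≤ 2 * b * exp (g 0) * s ^ 2 := by
    intro s hs
    have key := le_of_hasDerivAt_nonneg (f := fun r => 2 * b * exp (g 0) * r ^ 2 - p r)
      (f' := fun r => 2 * b * exp (g 0) * (2 * r) - r * F r) hs.1 ?_ ?_ ?_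
    · simp only [h.flux_zero] at key
      linarith
    · exact (by fun_prop : Continuous fun r : ℝ => 2 * b * exp (g 0) * r ^ 2).continuousOn.sub
        (h.continuousOn_flux.mono fun x hx => ⟨hx.1, (hx.2.trans hs.2).trans_lt hdT⟩)
    · intro x hx
      refine HasDerivAt.sub (HasDerivAt.const_mul _ ?_)
        (h.hasDerivAt_flux x ⟨hx.1, (hx.2.trans_le hs.2).trans hdT⟩)
      simpa using hasDerivAt_pow 2 x
    · intro x hx
      have := mul_le_mul_of_nonneg_left (hF x ⟨hx.1, hx.2.trans_le hs.2⟩) hx.1.le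
      linarith
  have h1 : g 0 ≤ g t + b := by
    have key := le_of_hasDerivAt_nonneg (f := fun r => g r + b * exp (g 0) * r ^ 2)
      (f' := fun r => -p r / r + b * exp (g 0) * (2 * r)) ht0.le ?_ ?_ ?_
    · have : exp (g 0) * t ^ 2 = 1 := by
        rw [ht, ← exp_nat_mul, ← exp_add]
        norm_num
        ring
      linear_combination key + b * this
    · exact (h.continuousOn.mono fun x hx => ⟨hx.1, (hx.2.trans htd).trans_lt hdT⟩).add
        (by fun_prop : Continuous fun r : ℝ => b * exp (g 0) * r ^ 2).continuousOn
    · intro x hx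
      refine HasDerivAt.add (h.hasDerivAt x ⟨hx.1, (hx.2.trans_le htd).trans hdT⟩)
        (HasDerivAt.const_mul _ ?_)
      simpa using hasDerivAt_pow 2 x
    · intro x hx
      have := hflux x ⟨hx.1.le, hx.2.le.trans htd⟩
      have h2 : p x / x ≤ b * exp (g 0) * (2 * x) := by
        rw [div_le_iff₀ hx.1]
        linarith
      rw [neg_div]
      linarith
  have h2 := h.le_flux_mul_log ha ht0 htd hdT
  have h3 : p d * (log d - log t) ≤ (2 - ε) * (log d - log t) :=
    mul_le_mul_of_nonneg_right hpd (sub_nonneg.2 (log_le_log ht0 htd))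
  have h4 : a * exp (g d) * d ^ 2 / 2 ≤ p d := by
    have key := le_of_hasDerivAt_nonneg (f := fun r => p r - a * exp (g d) * r ^ 2 / 2)
      (f' := fun r => r * F r - a * exp (g d) * (2 * r) / 2) hd.le ?_ ?_ ?_
    · simp only [h.flux_zero] at key
      linarith
    · exact (h.continuousOn_flux.mono fun x hx => ⟨hx.1, hx.2.trans_lt hdT⟩).sub
        (by fun_prop : Continuous fun r : ℝ => a * exp (g d) * r ^ 2 / 2).continuousOn
    · intro x hx
      refine HasDerivAt.sub (h.hasDerivAt_flux x ⟨hx.1, hx.2.trans hdT⟩)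
        (HasDerivAt.div_const (HasDerivAt.const_mul _ ?_) _)
      simpa using hasDerivAt_pow 2 x
    · intro x hx
      have h5 := h.flux_mul_log_le ha hx.1 hx.2.le hdT
      have h6 := mul_nonneg (h.flux_nonneg ha hx.1.le (hx.2.trans hdT))
        (sub_nonneg.2 (log_le_log hx.1 hx.2.le))
      have h7 : exp (g d) ≤ exp (g x) := exp_le_exp.2 (by linarith)
      have h8 := (mul_le_mul_of_nonneg_left h7 ha.le).trans (h.mul_exp_le x ⟨hx.1, hx.2.trans hdT⟩)
      have h9 := mul_le_mul_of_nonneg_left h8 hx.1.le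
      linarith
  have h5 : g d ≤ log (4 / a) - 2 * log d := by
    have h6 : exp (g d) ≤ 4 / a / d ^ 2 := by
      rw [le_div_iff₀ (by positivity), le_div_iff₀ ha]
      linarith
    have h7 := log_le_log (exp_pos _) h6
    rw [log_exp, log_div (by positivity) (by positivity), log_pow] at h7
    exact_mod_cast h7
  rw [hlogt] at h2 h3
  rw [le_div_iff₀ hε]
  linarith

end IsRadialProfile

theorem hasDerivAt_intervalIntegral_of_continuousOn {F F' : ℝ → ℝ → ℝ} {α β : ℝ} (s t : ℝ)
    (hF : ContinuousOn (Function.uncurry F) (Set.Ioo α β ×ˢ Set.univ))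
    (hF' : ContinuousOn (Function.uncurry F') (Set.Ioo α β ×ˢ Set.univ))
    (hd : ∀ r ∈ Set.Ioo α β, ∀ θ, HasDerivAt (fun x => F x θ) (F' r θ) r) {r : ℝ}
    (hr : r ∈ Set.Ioo α β) :
    HasDerivAt (fun x => ∫ θ in s..t, F x θ) (∫ θ in s..t, F' r θ) r := by
  have slice : ∀ {G : ℝ → ℝ → ℝ}, ContinuousOn (Function.uncurry G) (Set.Ioo α β ×ˢ Set.univ) →
      ∀ x ∈ Set.Ioo α β, Continuous (G x) := fun hG x hx =>
    hG.comp_continuous (f := fun θ => (x, θ)) (by fun_prop) fun θ => ⟨hx, trivial⟩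
  obtain ⟨δ, hδ, hball⟩ := Metric.nhds_basis_closedBall.mem_iff.1 (isOpen_Ioo.mem_nhds hr)
  obtain ⟨C, hC⟩ := ((isCompact_closedBall r δ).prod
    (isCompact_uIcc (a := s) (b := t))).exists_bound_of_continuousOn
    (hF'.mono (Set.prod_mono hball (Set.subset_univ _)))
  refine (intervalIntegral.hasDerivAt_integral_of_dominated_loc_of_deriv_le
    (bound := fun _ => C) (Metric.closedBall_mem_nhds r hδ) ?_
    ((slice hF r hr).intervalIntegrable _ _) (slice hF' r hr).aestronglyMeasurable ?_
    intervalIntegrable_const ?_).2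
  · filter_upwards [Metric.closedBall_mem_nhds r hδ] with x hx
    exact (slice hF x (hball hx)).aestronglyMeasurable
  · exact .of_forall fun θ hθ x hx => hC (x, θ) ⟨hx, Set.uIoc_subset_uIcc hθ⟩
  · exact .of_forall fun θ _ x hx => hd x (hball hx) θ

/-- The unit vector of angle `θ`. -/
noncomputable def radialDir (θ : ℝ) : EuclideanSpace ℝ (Fin 2) :=
  cos θ • EuclideanSpace.single 0 1 + sin θ • EuclideanSpace.single 1 1

/-- The derivative of `radialDir`. -/
noncomputable def angularDir (θ : ℝ) : EuclideanSpace ℝ (Fin 2) :=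
  -sin θ • EuclideanSpace.single 0 1 + cos θ • EuclideanSpace.single 1 1

@[fun_prop]
theorem continuous_radialDir : Continuous radialDir := by
  unfold radialDir; fun_prop

@[fun_prop]
theorem continuous_angularDir : Continuous angularDir := by
  unfold angularDir; fun_prop

theorem hasDerivAt_radialDir (θ : ℝ) : HasDerivAt radialDir (angularDir θ) θ :=
  ((hasDerivAt_cos θ).smul_const _).add ((hasDerivAt_sin θ).smul_const _)

theorem hasDerivAt_angularDir (θ : ℝ) : HasDerivAt angularDir (-radialDir θ) θ := by
  refine (((hasDerivAt_sin θ).neg.smul_const (EuclideanSpace.single (0 : Fin 2) (1 : ℝ))).add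
    ((hasDerivAt_cos θ).smul_const (EuclideanSpace.single (1 : Fin 2) (1 : ℝ)))).congr_deriv ?_
  rw [radialDir, neg_add, neg_smul, neg_smul]

theorem norm_radialDir (θ : ℝ) : ‖radialDir θ‖ = 1 := by
  simp [radialDir, EuclideanSpace.norm_eq]

section PolarCoordinates

variable {u : EuclideanSpace ℝ (Fin 2) → ℝ} {y : EuclideanSpace ℝ (Fin 2)} {T : ℝ}

theorem add_smul_radialDir_mem_ball {r : ℝ} (hr : r ∈ Set.Ioo (-T) T) (θ : ℝ) :
    y + r • radialDir θ ∈ ball y T := by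
  simpa [norm_smul, norm_radialDir] using abs_lt.2 hr

theorem lap_eq_radial_add_angular {x : EuclideanSpace ℝ (Fin 2)}
    (hu : DifferentiableAt ℝ (fderiv ℝ u) x) (θ : ℝ) :
    lap u x = fderiv ℝ (fderiv ℝ u) x (radialDir θ) (radialDir θ) +
      fderiv ℝ (fderiv ℝ u) x (angularDir θ) (angularDir θ) := by
  have h : ∀ v, fderiv ℝ (fun z => fderiv ℝ u z v) x v = fderiv ℝ (fderiv ℝ u) x v v := fun v => by
    rw [fderiv_clm_apply hu (differentiableAt_const v)]
    simp
  simp only [lap, h, Fin.sum_univ_two, radialDir, angularDir, map_add, map_smul,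
    add_apply, smul_apply, smul_eq_mul]
  linear_combination (-fderiv ℝ (fderiv ℝ u) x (EuclideanSpace.single 0 1)
    (EuclideanSpace.single 0 1) - fderiv ℝ (fderiv ℝ u) x (EuclideanSpace.single 1 1)
    (EuclideanSpace.single 1 1)) * sin_sq_add_cos_sq θ

theorem hasDerivAt_circleIntegral (hu : ContDiffOn ℝ 2 u (ball y T)) {r : ℝ}
    (hr : r ∈ Set.Ioo (-T) T) :
    HasDerivAt (fun x => ∫ θ in 0..2 * π, u (y + x • radialDir θ))
      (∫ θ in 0..2 * π, fderiv ℝ u (y + r • radialDir θ) (radialDir θ)) r := by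
  have hmaps : Set.MapsTo (fun q : ℝ × ℝ => y + q.1 • radialDir q.2)
      (Set.Ioo (-T) T ×ˢ Set.univ) (ball y T) := fun q hq => add_smul_radialDir_mem_ball hq.1 q.2
  have hcont : Continuous fun q : ℝ × ℝ => y + q.1 • radialDir q.2 := by fun_prop
  refine hasDerivAt_intervalIntegral_of_continuousOn
    (F := fun x θ => u (y + x • radialDir θ))
    (F' := fun x θ => fderiv ℝ u (y + x • radialDir θ) (radialDir θ)) 0 (2 * π)
    (hu.continuousOn.comp hcont.continuousOn hmaps) ?_ (fun x hx θ => ?_) hr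
  · exact ((hu.continuousOn_fderiv_of_isOpen isOpen_ball (by norm_num)).comp
      hcont.continuousOn hmaps).clm_apply (by fun_prop)
  · have hd : HasDerivAt (fun x : ℝ => y + x • radialDir θ) (radialDir θ) x := by
      simpa using ((hasDerivAt_id x).smul_const (radialDir θ)).const_add y
    exact (((hu.contDiffAt (isOpen_ball.mem_nhds (add_smul_radialDir_mem_ball hx θ))).differentiableAt
      (by norm_num)).hasFDerivAt.comp_hasDerivAt x hd)

theorem hasDerivAt_mul_circleIntegral_fderiv (hu : ContDiffOn ℝ 2 u (ball y T)) {r : ℝ}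
    (hr : r ∈ Set.Ioo (-T) T) :
    HasDerivAt (fun x => x * ∫ θ in 0..2 * π, fderiv ℝ u (y + x • radialDir θ) (radialDir θ))
      (r * ∫ θ in 0..2 * π, lap u (y + r • radialDir θ)) r := by
  have hmaps : Set.MapsTo (fun q : ℝ × ℝ => y + q.1 • radialDir q.2)
      (Set.Ioo (-T) T ×ˢ Set.univ) (ball y T) := fun q hq => add_smul_radialDir_mem_ball hq.1 q.2
  have hcont : Continuous fun q : ℝ × ℝ => y + q.1 • radialDir q.2 := by fun_prop
  have hu1 : ContDiffOn ℝ 1 (fderiv ℝ u) (ball y T) :=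
    hu.fderiv_of_isOpen isOpen_ball (by norm_num)
  have hdiff : ∀ x ∈ Set.Ioo (-T) T, ∀ θ, DifferentiableAt ℝ (fderiv ℝ u)
      (y + x • radialDir θ) := fun x hx θ =>
    (hu1.contDiffAt (isOpen_ball.mem_nhds (add_smul_radialDir_mem_ball hx θ))).differentiableAt
      (by norm_num)
  have hc1 : ContinuousOn (fun q : ℝ × ℝ => fderiv ℝ u (y + q.1 • radialDir q.2))
      (Set.Ioo (-T) T ×ˢ Set.univ) := hu1.continuousOn.comp hcont.continuousOn hmaps
  have hc2 : ContinuousOn (fun q : ℝ × ℝ => fderiv ℝ (fderiv ℝ u) (y + q.1 • radialDir q.2))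
      (Set.Ioo (-T) T ×ˢ Set.univ) := (hu1.continuousOn_fderiv_of_isOpen isOpen_ball (by norm_num)).comp
    hcont.continuousOn hmaps
  have hr1 : Continuous fun q : ℝ × ℝ => radialDir q.2 := by fun_prop
  have hslice : ContinuousOn (fun θ : ℝ => (r, θ)) Set.univ := by fun_prop
  have hmap : Set.MapsTo (fun θ : ℝ => (r, θ)) Set.univ (Set.Ioo (-T) T ×ˢ Set.univ) :=
    fun θ _ => ⟨hr, trivial⟩
  have hs1 : Continuous fun θ => fderiv ℝ u (y + r • radialDir θ) :=
    continuousOn_univ.1 (hc1.comp hslice hmap)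
  have hs2 : Continuous fun θ => fderiv ℝ (fderiv ℝ u) (y + r • radialDir θ) :=
    continuousOn_univ.1 (hc2.comp hslice hmap)

  have hint : HasDerivAt (fun x => ∫ θ in 0..2 * π, fderiv ℝ u (y + x • radialDir θ) (radialDir θ))
      (∫ θ in 0..2 * π, fderiv ℝ (fderiv ℝ u) (y + r • radialDir θ) (radialDir θ) (radialDir θ))
      r := by
    refine hasDerivAt_intervalIntegral_of_continuousOn
      (F := fun x θ => fderiv ℝ u (y + x • radialDir θ) (radialDir θ))
      (F' := fun x θ => fderiv ℝ (fderiv ℝ u) (y + x • radialDir θ) (radialDir θ) (radialDir θ))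
      0 (2 * π) (hc1.clm_apply hr1.continuousOn)
      ((hc2.clm_apply hr1.continuousOn).clm_apply hr1.continuousOn) (fun x hx θ => ?_) hr
    have hd : HasDerivAt (fun x : ℝ => y + x • radialDir θ) (radialDir θ) x := by
      simpa using ((hasDerivAt_id x).smul_const (radialDir θ)).const_add y
    have hd2 := (hdiff x hx θ).hasFDerivAt.comp_hasDerivAt x hd
    refine (hd2.clm_apply (hasDerivAt_const x (radialDir θ))).congr_deriv ?_
    rw [map_zero, add_zero]
  have hrad_int : IntervalIntegrable (fun θ => fderiv ℝ (fderiv ℝ u) (y + r • radialDir θ)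
      (radialDir θ) (radialDir θ)) volume 0 (2 * π) :=
    ((hs2.clm_apply continuous_radialDir).clm_apply continuous_radialDir).intervalIntegrable _ _
  have hang_int : IntervalIntegrable (fun θ => fderiv ℝ (fderiv ℝ u) (y + r • radialDir θ)
      (angularDir θ) (angularDir θ)) volume 0 (2 * π) :=
    ((hs2.clm_apply continuous_angularDir).clm_apply continuous_angularDir).intervalIntegrable _ _
  have hgrad_int : IntervalIntegrable (fun θ => fderiv ℝ u (y + r • radialDir θ) (radialDir θ))
      volume 0 (2 * π) := (hs1.clm_apply continuous_radialDir).intervalIntegrable _ _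
  have hang : ∫ θ in 0..2 * π, (r * fderiv ℝ (fderiv ℝ u) (y + r • radialDir θ) (angularDir θ)
      (angularDir θ) - fderiv ℝ u (y + r • radialDir θ) (radialDir θ)) = 0 := by
    rw [intervalIntegral.integral_eq_sub_of_hasDerivAt
      (f := fun θ => fderiv ℝ u (y + r • radialDir θ) (angularDir θ)) (fun θ _ => ?_)
      ((hang_int.const_mul r).sub hgrad_int)]
    · simp [radialDir, angularDir]
    · have hd : HasDerivAt (fun θ : ℝ => y + r • radialDir θ) (r • angularDir θ) θ :=
        ((hasDerivAt_radialDir θ).const_smul r).const_add y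
      have hd2 := (hdiff r hr θ).hasFDerivAt.comp_hasDerivAt θ hd
      refine (hd2.clm_apply (hasDerivAt_angularDir θ)).congr_deriv ?_
      rw [map_smul, map_neg, smul_apply, smul_eq_mul, sub_eq_add_neg]
      rfl
  rw [intervalIntegral.integral_sub (hang_int.const_mul r) hgrad_int,
    intervalIntegral.integral_const_mul] at hang
  refine ((hasDerivAt_id r).mul hint).congr_deriv ?_
  have hlap : ∫ θ in 0..2 * π, lap u (y + r • radialDir θ) =
      (∫ θ in 0..2 * π, fderiv ℝ (fderiv ℝ u) (y + r • radialDir θ) (radialDir θ) (radialDir θ)) +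
      ∫ θ in 0..2 * π, fderiv ℝ (fderiv ℝ u) (y + r • radialDir θ) (angularDir θ)
        (angularDir θ) := by
    rw [← intervalIntegral.integral_add hrad_int hang_int]
    exact intervalIntegral.integral_congr fun θ _ => lap_eq_radial_add_angular (hdiff r hr θ) θ
  rw [hlap, id]
  linear_combination -hang

theorem continuousOn_lap (hu : ContDiffOn ℝ 2 u (ball y T)) : ContinuousOn (lap u) (ball y T) := by
  have hu1 : ContDiffOn ℝ 1 (fderiv ℝ u) (ball y T) :=
    hu.fderiv_of_isOpen isOpen_ball (by norm_num)
  have hc := hu1.continuousOn_fderiv_of_isOpen isOpen_ball (by norm_num)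
  refine (((hc.clm_apply continuousOn_const).clm_apply continuousOn_const).add
    ((hc.clm_apply continuousOn_const).clm_apply continuousOn_const)).congr fun x hx =>
    lap_eq_radial_add_angular ((hu1.contDiffAt (isOpen_ball.mem_nhds hx)).differentiableAt
      (by norm_num)) 0

theorem inv_two_pi_mul_integral_mono {f h : ℝ → ℝ} (hf : Continuous f) (hh : Continuous h)
    (hfh : ∀ θ, f θ ≤ h θ) :
    (2 * π)⁻¹ * ∫ θ in 0..2 * π, f θ ≤ (2 * π)⁻¹ * ∫ θ in 0..2 * π, h θ :=
  mul_le_mul_of_nonneg_left (intervalIntegral.integral_mono two_pi_pos.le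
    (hf.intervalIntegrable _ _) (hh.intervalIntegrable _ _) hfh) (by positivity)

theorem inv_two_pi_mul_integral_const (c : ℝ) : (2 * π)⁻¹ * ∫ _ in 0..2 * π, c = c := by
  rw [intervalIntegral.integral_const, sub_zero, smul_eq_mul, inv_mul_cancel_left₀ two_pi_pos.ne']

theorem exists_isRadialProfile {a m : ℝ} (ha : 0 < a) (hu : ContDiffOn ℝ 2 u (ball y T))
    (hm : ∀ x ∈ ball y T, m ≤ u x) (hlap : ∀ x ∈ ball y T, a * exp (u x) ≤ -lap u x) :
    ∃ g p F, IsRadialProfile a T g p F ∧ g 0 = u y ∧ (∀ r ∈ Set.Ico 0 T, m ≤ g r) ∧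
      ∀ r ∈ Set.Ioo 0 T, ∀ C, (∀ x ∈ sphere y r, -lap u x ≤ C) → F r ≤ C := by
  have hmem : ∀ {r}, r ∈ Set.Ico 0 T → r ∈ Set.Ioo (-T) T := fun {r} hr =>
    ⟨by linarith [hr.1, hr.2], hr.2⟩
  have hcirc : ∀ r ∈ Set.Ioo (-T) T, ∀ f : EuclideanSpace ℝ (Fin 2) → ℝ,
      ContinuousOn f (ball y T) → Continuous fun θ => f (y + r • radialDir θ) := fun r hr f hf =>
    hf.comp_continuous (by fun_prop) (add_smul_radialDir_mem_ball hr)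
  have hg := fun r (hr : r ∈ Set.Ico 0 T) =>
    (hasDerivAt_circleIntegral hu (hmem hr)).const_mul (2 * π)⁻¹
  have hp := fun r (hr : r ∈ Set.Ico 0 T) =>
    (hasDerivAt_mul_circleIntegral_fderiv hu (hmem hr)).const_mul (-(2 * π)⁻¹)
  refine ⟨fun r => (2 * π)⁻¹ * ∫ θ in 0..2 * π, u (y + r • radialDir θ), _,
    fun r => (2 * π)⁻¹ * ∫ θ in 0..2 * π, -lap u (y + r • radialDir θ),
    ⟨fun r hr => (hg r hr).continuousAt.continuousWithinAt,
      fun r hr => (hp r hr).continuousAt.continuousWithinAt, by simp, fun r hr => ?_,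
      fun r hr => ?_, fun r hr => ?_⟩, ?_, fun r hr => ?_, fun r hr C hC => ?_⟩
  · refine (hg r ⟨hr.1.le, hr.2⟩).congr_deriv ?_
    have := hr.1.ne'
    field_simp
  · refine (hp r ⟨hr.1.le, hr.2⟩).congr_deriv ?_
    rw [intervalIntegral.integral_neg]
    ring
  · have hr' := hmem ⟨hr.1.le, hr.2⟩
    set G := (2 * π)⁻¹ * ∫ θ in 0..2 * π, u (y + r • radialDir θ) with hG
    have hcu := hcirc r hr' u hu.continuousOn
    have key := inv_two_pi_mul_integral_mono
      (f := fun θ => a * exp G * (1 - G) + a * exp G * u (y + r • radialDir θ))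
      (h := fun θ => -lap u (y + r • radialDir θ)) (continuous_const.add (hcu.const_mul _))
      (hcirc r hr' _ (continuousOn_lap hu).neg) fun θ => by
        refine le_trans ?_ (hlap _ (add_smul_radialDir_mem_ball hr' θ))
        have h1 := mul_le_mul_of_nonneg_left (add_one_le_exp (u (y + r • radialDir θ) - G))
          (mul_pos ha (exp_pos G)).le
        have h2 : exp G * exp (u (y + r • radialDir θ) - G) = exp (u (y + r • radialDir θ)) := by
          rw [← exp_add, add_sub_cancel]
        linear_combination h1 + a * h2
    rw [intervalIntegral.integral_add (by simp)
      ((hcu.const_mul _).intervalIntegrable _ _), mul_add, inv_two_pi_mul_integral_const,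
      intervalIntegral.integral_const_mul, mul_left_comm, ← hG] at key
    linarith
  · simp only [zero_smul, add_zero, inv_two_pi_mul_integral_const]
  · simpa only [inv_two_pi_mul_integral_const] using inv_two_pi_mul_integral_mono continuous_const
      (hcirc r (hmem hr) u hu.continuousOn)
      fun θ => hm _ (add_smul_radialDir_mem_ball (hmem hr) θ)
  · simpa only [inv_two_pi_mul_integral_const] using inv_two_pi_mul_integral_mono
      (f := fun θ => -lap u (y + r • radialDir θ))
      (hcirc r (hmem ⟨hr.1.le, hr.2⟩) _ (continuousOn_lap hu).neg) continuous_const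
      fun θ => hC _ (by simp [norm_smul, norm_radialDir, hr.1.le])

end PolarCoordinates

theorem exists_uniform_bound_of_ball {a b m R : ℝ} (ha : 0 < a) (hb : 0 < b) (hR : 0 < R) :
    ∃ c : ℝ, ∀ (u : EuclideanSpace ℝ (Fin 2) → ℝ) (x₀ : EuclideanSpace ℝ (Fin 2)),
      ContDiffOn ℝ 2 u (ball x₀ (6 * R)) → (∀ x ∈ ball x₀ (6 * R), m ≤ u x) →
      (∀ x ∈ ball x₀ (6 * R), a * exp (u x) ≤ -lap u x) →
      (∀ x ∈ ball x₀ (6 * R), -lap u x ≤ b * exp (u x)) → u x₀ ≤ c := by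
  obtain ⟨ρ, ⟨hρ0, hρR⟩, ε, hε, hflux⟩ :=
    IsRadialProfile.exists_flux_le_two_sub (T := 5 * R) m ha hR (by linarith)
  set C := max 0 (2 * (b + log (4 / a)) / ε)
  refine ⟨C + 2 * log 2 - 2 * log ρ, fun u x₀ hu hm hlap hlap' => ?_⟩
  have hsub : closedBall x₀ ρ ⊆ ball x₀ (6 * R) := closedBall_subset_ball (by linarith)
  obtain ⟨y, hy, hmax⟩ := (isCompact_closedBall x₀ ρ).exists_isMaxOn
    (f := fun x => (ρ - dist x x₀) ^ 2 * exp (u x)) ⟨x₀, mem_closedBall_self hρ0.le⟩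
    (by
      have := hu.continuousOn.mono hsub
      fun_prop)
  have hmax0 : ρ ^ 2 * exp (u x₀) ≤ (ρ - dist y x₀) ^ 2 * exp (u y) := by
    simpa using hmax (mem_closedBall_self hρ0.le)
  rw [mem_closedBall] at hy
  have hylt : dist y x₀ < ρ := by
    refine lt_of_le_of_ne hy fun h => ?_
    rw [h, sub_self] at hmax0
    have : 0 < ρ ^ 2 * exp (u x₀) := by positivity
    linarith
  set d := (ρ - dist y x₀) / 2 with hd
  have hd0 : 0 < d := by linarith
  have hdρ : d ≤ ρ := by linarith [dist_nonneg (x := y) (y := x₀)]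
  have hyball : ball y (5 * R) ⊆ ball x₀ (6 * R) := ball_subset_ball' (by linarith)
  obtain ⟨g, p, F, h, hg0, hgm, hF⟩ := exists_isRadialProfile ha (hu.mono hyball)
    (fun x hx => hm x (hyball hx)) (fun x hx => hlap x (hyball hx))
  have hfd : p d ≤ 2 - ε :=
    (h.flux_le ha hd0.le hdρ (by linarith)).trans (hflux g p F h hgm)
  have key : g 0 + 2 * log d ≤ C := by
    refine h.apply_zero_add_log_le ha hd0 (by linarith) hε hfd fun r hr =>
      hF r ⟨hr.1, by linarith [hr.2]⟩ _ fun x hx => ?_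
    rw [mem_sphere] at hx
    have hxd : dist x x₀ ≤ ρ - d := by linarith [dist_triangle x y x₀, hr.2]
    have hxρ : x ∈ closedBall x₀ ρ := mem_closedBall.2 (by linarith)
    have h1 : (ρ - dist x x₀) ^ 2 * exp (u x) ≤ (ρ - dist y x₀) ^ 2 * exp (u y) := hmax hxρ
    have h2 : d ^ 2 ≤ (ρ - dist x x₀) ^ 2 := pow_le_pow_left₀ hd0.le (by linarith) 2
    have h3 := mul_le_mul_of_nonneg_right h2 (exp_pos (u x)).le
    rw [show ρ - dist y x₀ = 2 * d by linarith] at h1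
    have h4 : exp (u x) ≤ 4 * exp (u y) := by
      refine le_of_mul_le_mul_left ?_ (pow_pos hd0 2)
      linarith
    have h5 := mul_le_mul_of_nonneg_left h4 hb.le
    have h6 := hlap' x (hsub hxρ)
    rw [hg0]
    linarith
  rw [show ρ - dist y x₀ = 2 * d by linarith] at hmax0
  have hlog := log_le_log (by positivity) hmax0
  rw [log_mul (by positivity) (exp_pos _).ne', log_mul (by positivity) (exp_pos _).ne', log_exp,
    log_exp, log_pow, log_pow, log_mul two_ne_zero hd0.ne'] at hlog
  push_cast at hlog
  rw [hg0] at key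
  linarith

/-- Brezis–Merle interior estimate: if `-Δu = V e^u` in `Ω`, `0 < a ≤ V ≤ b`, and
`inf_Ω u ≥ m`, then `sup_K u ≤ c(a,b,m,K,Ω)` for every compact `K ⊂ Ω`. -/
theorem brezis_merle_interior_estimate
    (Ω : Set (EuclideanSpace ℝ (Fin 2))) (hΩ_open : IsOpen Ω) (hΩ_bdd : Bornology.IsBounded Ω)
    (K : Set (EuclideanSpace ℝ (Fin 2))) (hK : IsCompact K) (hKΩ : K ⊆ Ω)
    (a b m : ℝ) (ha : 0 < a) (hab : a ≤ b) :
    ∃ c : ℝ,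
      ∀ u V : EuclideanSpace ℝ (Fin 2) → ℝ,
        ContDiffOn ℝ 2 u Ω →
        (∀ x ∈ Ω, a ≤ V x) →
        (∀ x ∈ Ω, V x ≤ b) →
        (∀ x ∈ Ω, -lap u x = V x * exp (u x)) →
        (∀ x ∈ Ω, m ≤ u x) →
        ∀ x ∈ K, u x ≤ c := by
  obtain ⟨δ, hδ, hδΩ⟩ := hK.exists_thickening_subset_open hΩ_open hKΩ
  obtain ⟨c, hc⟩ := exists_uniform_bound_of_ball (m := m) ha (ha.trans_le hab)
    (show 0 < δ / 6 by linarith)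
  refine ⟨c, fun u V hu haV hVb heq hm x hx => ?_⟩
  have hball : ball x (6 * (δ / 6)) ⊆ Ω := by
    rw [mul_div_cancel₀ δ (by norm_num)]
    exact (ball_subset_thickening hx δ).trans hδΩ
  refine hc u x (hu.mono hball) (fun z hz => hm z (hball hz)) (fun z hz => ?_) fun z hz => ?_
  · rw [heq z (hball hz)]
    exact mul_le_mul_of_nonneg_right (haV z (hball hz)) (exp_pos _).le
  · rw [heq z (hball hz)]
    exact mul_le_mul_of_nonneg_right (hVb z (hball hz)) (exp_pos _).le
end

section
/- (Wolansky's mass quantization.) Let Ω ⊂ ℝ² be a bounded open set and b, C₁, C₂, C₃ > 0. Let (u_i) be a sequence of functions C² on Ω and continuous on the closure of Ω, and (V_i) a sequence of C¹ functions on Ω with 0 ≤ V_i ≤ b and |∇V_i| ≤ C₁ on Ω, satisfying −Δu_i = V_i e^{u_i} in Ω, ∫_Ω e^{u_i} dy ≤ C₂, and sup_{∂Ω} u_i − inf_{∂Ω} u_i ≤ C₃. Assume there exist finitely many distinct points x_1, …, x_m ∈ Ω and real numbers α_1, …, α_m with α_j ≥ 4π such that u_i → −∞ uniformly on every compact subset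 of Ω ∖ {x_1, …, x_m} and V_i e^{u_i} converges to Σ_{j=1}^m α_j δ_{x_j} in the sense of distributions on Ω (i.e., ∫_Ω φ V_i e^{u_i} dy → Σ_j α_j φ(x_j) for every continuous compactly supported φ : Ω → ℝ). Then α_j = 8π for every j = 1, …, m. -/
open MeasureTheory Metric Real Filter Topology

/-- The Euclidean plane. -/
abbrev Plane := EuclideanSpace ℝ (Fin 2)

section Calculus

theorem contDiffAt_fderiv_apply {f : Plane → ℝ} {x : Plane} (hf : ContDiffAt ℝ 2 f x) (v : Plane) :
    ContDiffAt ℝ 1 (fun y => fderiv ℝ f y v) x :=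
  (hf.fderiv_right (m := 1) (by norm_num)).clm_apply contDiffAt_const

theorem differentiableAt_fderiv_apply {f : Plane → ℝ} {x : Plane} (hf : ContDiffAt ℝ 2 f x)
    (v : Plane) : DifferentiableAt ℝ (fun y => fderiv ℝ f y v) x :=
  (contDiffAt_fderiv_apply hf v).differentiableAt (by norm_num)

theorem ContDiffAt.eventually_differentiableAt_of_two {f : Plane → ℝ} {x : Plane}
    (hf : ContDiffAt ℝ 2 f x) : ∀ᶠ y in 𝓝 x, DifferentiableAt ℝ f y :=
  (hf.eventually (by simp)).mono fun _ hy => hy.differentiableAt (by norm_num)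

theorem lap_congr {f g : Plane → ℝ} {x : Plane} (h : f =ᶠ[𝓝 x] g) : lap f x = lap g x := by
  unfold lap
  refine Finset.sum_congr rfl fun i _ => ?_
  have : (fun y => fderiv ℝ f y (EuclideanSpace.single i 1)) =ᶠ[𝓝 x]
      fun y => fderiv ℝ g y (EuclideanSpace.single i 1) := by
    filter_upwards [h.eventuallyEq_nhds] with y hy
    rw [hy.fderiv_eq]
  rw [this.fderiv_eq]

theorem lap_mul {f g : Plane → ℝ} {x : Plane} (hf : ContDiffAt ℝ 2 f x)
    (hg : ContDiffAt ℝ 2 g x) :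
    lap (fun y => f y * g y) x = f x * lap g x + g x * lap f x +
      2 * ∑ i : Fin 2, fderiv ℝ f x (EuclideanSpace.single i 1) *
        fderiv ℝ g x (EuclideanSpace.single i 1) := by
  unfold lap
  simp only [Finset.mul_sum, ← Finset.sum_add_distrib]
  refine Finset.sum_congr rfl fun i _ => ?_
  set e : Plane := EuclideanSpace.single i 1
  have h : (fun y => fderiv ℝ (fun z => f z * g z) y e) =ᶠ[𝓝 x]
      fun y => f y * fderiv ℝ g y e + g y * fderiv ℝ f y e := by
    filter_upwards [hf.eventually_differentiableAt_of_two,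
      hg.eventually_differentiableAt_of_two] with y h1 h2
    rw [fderiv_fun_mul h1 h2]
    simp
  have hf1 := hf.differentiableAt (by norm_num)
  have hg1 := hg.differentiableAt (by norm_num)
  have hf2 := differentiableAt_fderiv_apply hf e
  have hg2 := differentiableAt_fderiv_apply hg e
  rw [h.fderiv_eq, fderiv_fun_add (hf1.fun_mul hg2) (hg1.fun_mul hf2), fderiv_fun_mul hf1 hg2,
    fderiv_fun_mul hg1 hf2]
  simp
  ring

theorem lap_comp {Φ : ℝ → ℝ} {w : Plane → ℝ} {x : Plane} (hΦ : ContDiff ℝ 2 Φ)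
    (hw : ContDiffAt ℝ 2 w x) :
    lap (fun y => Φ (w y)) x = deriv Φ (w x) * lap w x +
      deriv (deriv Φ) (w x) * ∑ i : Fin 2, fderiv ℝ w x (EuclideanSpace.single i 1) ^ 2 := by
  unfold lap
  simp only [Finset.mul_sum, ← Finset.sum_add_distrib]
  refine Finset.sum_congr rfl fun i _ => ?_
  set e : Plane := EuclideanSpace.single i 1
  have hΦ1 : Differentiable ℝ Φ := hΦ.differentiable (by norm_num)
  have hΦ2 : Differentiable ℝ (deriv Φ) :=
    (ContDiff.deriv' (n := 1) (by rwa [one_add_one_eq_two])).differentiable (by norm_num)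
  have h : (fun y => fderiv ℝ (fun z => Φ (w z)) y e) =ᶠ[𝓝 x]
      fun y => deriv Φ (w y) * fderiv ℝ w y e := by
    filter_upwards [hw.eventually_differentiableAt_of_two] with y h1
    have := (hΦ1 (w y)).hasDerivAt.comp_hasFDerivAt y h1.hasFDerivAt
    rw [show (fun z => Φ (w z)) = Φ ∘ w from rfl, this.fderiv]
    simp
  have hw1 := hw.differentiableAt (by norm_num)
  have hw2 := differentiableAt_fderiv_apply hw e
  have h3 := (hΦ2 (w x)).hasDerivAt.comp_hasFDerivAt x hw1.hasFDerivAt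
  have h4 : HasFDerivAt (fun y => deriv Φ (w y)) (deriv (deriv Φ) (w x) • fderiv ℝ w x) x := h3
  rw [h.fderiv_eq, (h4.fun_mul hw2.hasFDerivAt).fderiv]
  simp
  ring

theorem lap_sub_const (f : Plane → ℝ) (c : ℝ) (x : Plane) : lap (fun y => f y - c) x = lap f x := by
  unfold lap
  simp [fderiv_sub_const]

theorem lap_const_sub (f : Plane → ℝ) (c : ℝ) (x : Plane) :
    lap (fun y => c - f y) x = -lap f x := by
  unfold lap
  simp [fderiv_const_sub]

theorem continuous_lap {f : Plane → ℝ} (hf : ContDiff ℝ 2 f) : Continuous (lap f) := by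
  unfold lap
  refine continuous_finsetSum _ fun i _ => ?_
  have h : ContDiff ℝ 1 (fun y => fderiv ℝ f y (EuclideanSpace.single i 1)) :=
    contDiff_iff_contDiffAt.2 fun x => contDiffAt_fderiv_apply hf.contDiffAt _
  exact (h.continuous_fderiv (by norm_num)).clm_apply continuous_const

theorem lap_eq_zero_of_notMem_tsupport {f : Plane → ℝ} {x : Plane} (hx : x ∉ tsupport f) :
    lap f x = 0 := by
  rw [lap_congr (notMem_tsupport_iff_eventuallyEq.1 hx)]
  simp [lap]

theorem HasCompactSupport.lap {f : Plane → ℝ} (hf : HasCompactSupport f) :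
    HasCompactSupport (lap f) :=
  HasCompactSupport.intro hf fun _ hx => lap_eq_zero_of_notMem_tsupport hx

theorem integral_mul_fderiv_eq_neg {f g : Plane → ℝ} (hf : ContDiff ℝ 1 f) (hg : ContDiff ℝ 1 g)
    (hc : HasCompactSupport g) (v : Plane) :
    ∫ x, f x * fderiv ℝ g x v = -∫ x, fderiv ℝ f x v * g x := by
  have hf' := (hf.continuous_fderiv (by norm_num)).clm_apply (continuous_const (y := v))
  have hg' := (hg.continuous_fderiv (by norm_num)).clm_apply (continuous_const (y := v))
  have hc' : HasCompactSupport (fun x => fderiv ℝ g x v) := hc.fderiv_apply (𝕜 := ℝ) v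
  exact integral_mul_fderiv_eq_neg_fderiv_mul_of_integrable
    ((hf'.mul hg.continuous).integrable_of_hasCompactSupport hc.mul_left)
    ((hf.continuous.mul hg').integrable_of_hasCompactSupport hc'.mul_left)
    ((hf.continuous.mul hg.continuous).integrable_of_hasCompactSupport hc.mul_left)
    (fun x _ => hf.differentiable (by norm_num) x) (fun x _ => hg.differentiable (by norm_num) x)

/-- Green's second identity when one of the functions has compact support. -/
theorem integral_mul_lap_eq {f g : Plane → ℝ} (hf : ContDiff ℝ 2 f) (hg : ContDiff ℝ 2 g)
    (hc : HasCompactSupport g) :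
    ∫ x, f x * lap g x = ∫ x, lap f x * g x := by
  have hf1 : ContDiff ℝ 1 f := hf.of_le (by norm_num)
  have hg1 : ContDiff ℝ 1 g := hg.of_le (by norm_num)
  have hf2 : ∀ v, ContDiff ℝ 1 (fun y => fderiv ℝ f y v) := fun v =>
    contDiff_iff_contDiffAt.2 fun x => contDiffAt_fderiv_apply hf.contDiffAt v
  have hg2 : ∀ v, ContDiff ℝ 1 (fun y => fderiv ℝ g y v) := fun v =>
    contDiff_iff_contDiffAt.2 fun x => contDiffAt_fderiv_apply hg.contDiffAt v
  have hf3 : ∀ v, Continuous (fun y => fderiv ℝ (fun z => fderiv ℝ f z v) y v) := fun v =>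
    ((hf2 v).continuous_fderiv (by norm_num)).clm_apply continuous_const
  have hg3 : ∀ v, Continuous (fun y => fderiv ℝ (fun z => fderiv ℝ g z v) y v) := fun v =>
    ((hg2 v).continuous_fderiv (by norm_num)).clm_apply continuous_const
  have hc1 : ∀ v, HasCompactSupport (fun y => fderiv ℝ g y v) := fun v =>
    hc.fderiv_apply (𝕜 := ℝ) v
  have hc2 : ∀ v, HasCompactSupport (fun y => fderiv ℝ (fun z => fderiv ℝ g z v) y v) :=
    fun v => (hc1 v).fderiv_apply (𝕜 := ℝ) v
  unfold lap
  simp only [Finset.mul_sum, Finset.sum_mul]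
  rw [integral_finsetSum, integral_finsetSum]
  · refine Finset.sum_congr rfl fun i _ => ?_
    rw [integral_mul_fderiv_eq_neg hf1 (hg2 _) (hc1 _),
      integral_mul_fderiv_eq_neg (hf2 _) hg1 hc, neg_neg]
  · exact fun i _ => ((hf3 _).mul hg.continuous).integrable_of_hasCompactSupport hc.mul_left
  · exact fun i _ => (hf.continuous.mul (hg3 _)).integrable_of_hasCompactSupport (hc2 _).mul_left

theorem fderiv_norm_sub_sq (c y v : Plane) :
    fderiv ℝ (fun y => ‖y - c‖ ^ 2) y v = 2 * inner ℝ (y - c) v := by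
  have h := ((hasFDerivAt_id y).sub_const c).norm_sq
  simp only [id] at h
  rw [h.fderiv]
  simp [inner_sub_left]

theorem sum_inner_single_mul (v w : Plane) :
    ∑ i : Fin 2, inner ℝ v (EuclideanSpace.single i 1) * inner ℝ w (EuclideanSpace.single i 1) =
      inner ℝ v w := by
  simp [PiLp.inner_apply, mul_comm]

theorem lap_norm_sub_sq (c x : Plane) : lap (fun y => ‖y - c‖ ^ 2) x = 4 := by
  unfold lap
  simp only [fderiv_norm_sub_sq]
  have : ∀ i : Fin 2, fderiv ℝ (fun y : Plane => 2 * inner ℝ (y - c)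
      (EuclideanSpace.single i (1 : ℝ))) x (EuclideanSpace.single i 1) = 2 := by
    intro i
    have h := (((hasFDerivAt_id x).sub_const c).inner ℝ
      (hasFDerivAt_const (EuclideanSpace.single i (1 : ℝ)) x)).const_mul 2
    simp only [id] at h
    rw [h.fderiv]
    simp
  simp only [this]
  norm_num

end Calculus

section BoundaryControl

/-- A smooth convex regularization of the positive part. -/
theorem exists_convex_cutoff : ∃ Φ : ℝ → ℝ, ContDiff ℝ 2 Φ ∧ (∀ t ≤ 0, Φ t = 0) ∧
    (∀ t, 0 ≤ deriv Φ t) ∧ (∀ t, deriv Φ t ≤ 1) ∧ (∀ t, 0 ≤ deriv (deriv Φ) t) ∧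
    (∀ t, 0 ≤ Φ t) ∧ ∀ t, t - 1 ≤ Φ t := by
  set S := Real.smoothTransition
  have hS : Continuous S := Real.smoothTransition.continuous
  let Φ : ℝ → ℝ := fun t => ∫ s in (0 : ℝ)..t, S s
  have hd : ∀ t, HasDerivAt Φ (S t) t := fun t => hS.integral_hasStrictDerivAt 0 t |>.hasDerivAt
  have hderiv : deriv Φ = S := funext fun t => (hd t).deriv
  have hcd : ContDiff ℝ 1 S := Real.smoothTransition.contDiff (n := 1)
  have hmono : Monotone Φ := monotone_of_deriv_nonneg (fun t => (hd t).differentiableAt)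
    fun t => by rw [hderiv]; exact Real.smoothTransition.nonneg t
  have hneg : ∀ t ≤ 0, Φ t = 0 := by
    intro t ht
    have : ∫ s in (0 : ℝ)..t, S s = ∫ s in (0 : ℝ)..t, (0 : ℝ) := by
      refine intervalIntegral.integral_congr fun s hs => ?_
      rw [Set.uIcc_of_ge ht] at hs
      exact Real.smoothTransition.zero_of_nonpos hs.2
    simpa [Φ] using this
  have hpos : ∀ t, 0 ≤ Φ t := by
    intro t
    rcases le_total t 0 with h | h
    · exact (hneg t h).ge
    · simpa [hneg 0 le_rfl] using hmono h
  refine ⟨Φ, ?_, hneg, ?_, ?_, ?_, hpos, ?_⟩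
  · have : ContDiff ℝ (1 + 1) Φ := contDiff_succ_iff_deriv.2
      ⟨fun t => (hd t).differentiableAt, by simp, by rw [hderiv]; exact hcd⟩
    simpa [one_add_one_eq_two] using this
  · intro t; rw [hderiv]; exact Real.smoothTransition.nonneg t
  · intro t; rw [hderiv]; exact Real.smoothTransition.le_one t
  · intro t; rw [hderiv]; exact Real.smoothTransition.monotone.deriv_nonneg
  · intro t
    rcases le_total t 1 with h | h
    · linarith [hpos t]
    · have h1 : ∫ s in (1 : ℝ)..t, S s = ∫ s in (1 : ℝ)..t, (1 : ℝ) := by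
        refine intervalIntegral.integral_congr fun s hs => ?_
        rw [Set.uIcc_of_le h] at hs
        exact Real.smoothTransition.one_of_one_le hs.1
      have h2 : Φ 1 + ∫ s in (1 : ℝ)..t, S s = Φ t :=
        intervalIntegral.integral_add_adjacent_intervals (hS.intervalIntegrable _ _)
          (hS.intervalIntegrable _ _)
      have h3 := hpos 1
      rw [h1] at h2
      simp at h2
      linarith

/-- A bound on the positive part of a function with nonpositive boundary values in terms of the
total mass of a majorant of minus its Laplacian; no regularity of the domain is needed. -/
theorem setIntegral_posPart_le {Ω : Set Plane} (hΩ : IsOpen Ω) {R : ℝ}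
    (hR : Ω ⊆ closedBall 0 R) {w h : Plane → ℝ} (hw : ContDiffOn ℝ 2 w Ω)
    (hwc : ContinuousOn w (closure Ω)) (hbd : ∀ x ∈ frontier Ω, w x ≤ 0)
    (hh : ∀ x ∈ Ω, 0 ≤ h x) (hhi : IntegrableOn h Ω) (hlap : ∀ x ∈ Ω, -lap w x ≤ h x) :
    ∫ x in Ω, max (w x) 0 ≤ R ^ 2 / 4 * (∫ x in Ω, h x) + 2 * volume.real Ω := by
  obtain ⟨Φ, hΦ, hΦ0, hΦ1, hΦ2, hΦ3, hΦ4, hΦ5⟩ := exists_convex_cutoff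
  have hΩb : Bornology.IsBounded Ω := isBounded_closedBall.subset hR
  have hΩfin : volume Ω ≠ ⊤ := hΩb.measure_lt_top.ne
  set K : Set Plane := closure Ω ∩ w ⁻¹' Set.Ici 1
  have hKc : IsClosed K := hwc.preimage_isClosed_of_isClosed isClosed_closure isClosed_Ici
  have hK : IsCompact K :=
    Metric.isCompact_of_isClosed_isBounded hKc (hΩb.closure.subset Set.inter_subset_left)
  have hKΩ : K ⊆ Ω := by
    rintro x ⟨hx, hx1⟩
    by_contra hxΩ
    have := hbd x ⟨hx, by rwa [hΩ.interior_eq]⟩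
    simp only [Set.mem_preimage, Set.mem_Ici] at hx1
    linarith
  set g : Plane → ℝ := Ω.indicator fun x => Φ (w x - 1)
  have hgK : ∀ x ∉ K, g x = 0 := by
    intro x hx
    by_cases hxΩ : x ∈ Ω
    · have : w x < 1 := by
        by_contra hc
        exact hx ⟨subset_closure hxΩ, not_lt.1 hc⟩
      simp only [g, Set.indicator_of_mem hxΩ]
      exact hΦ0 _ (by linarith)
    · exact Set.indicator_of_notMem hxΩ _
  have hg_in : ∀ x ∈ Ω, g =ᶠ[𝓝 x] fun x => Φ (w x - 1) := fun x hx => by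
    filter_upwards [hΩ.mem_nhds hx] with y hy
    exact Set.indicator_of_mem hy _
  have hg_out : ∀ x ∉ Ω, g =ᶠ[𝓝 x] fun _ => (0 : ℝ) := fun x hx => by
    filter_upwards [hKc.isOpen_compl.mem_nhds fun hxK => hx (hKΩ hxK)] with y hy
    exact hgK y hy
  have hwat : ∀ x ∈ Ω, ContDiffAt ℝ 2 (fun x => w x - 1) x := fun x hx =>
    (hw.contDiffAt (hΩ.mem_nhds hx)).sub contDiffAt_const
  have hg2 : ContDiff ℝ 2 g := by
    refine contDiff_iff_contDiffAt.2 fun x => ?_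
    by_cases hx : x ∈ Ω
    · exact (hΦ.contDiffAt.comp x (hwat x hx)).congr_of_eventuallyEq (hg_in x hx)
    · exact contDiffAt_const.congr_of_eventuallyEq (hg_out x hx)
  have hgc : HasCompactSupport g := HasCompactSupport.intro hK hgK
  set ζ : Plane → ℝ := fun x => (R ^ 2 - ‖x - 0‖ ^ 2) * (1 / 4)
  have hζ : ContDiff ℝ 2 ζ := by
    have : ContDiff ℝ 2 fun x : Plane => ‖x - 0‖ ^ 2 := (contDiff_id.sub contDiff_const).norm_sq ℝ
    exact (contDiff_const.sub this).mul contDiff_const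
  have hζlap : ∀ x, lap ζ x = -1 := by
    intro x
    have h1 : ContDiff ℝ 2 fun x : Plane => R ^ 2 - ‖x - 0‖ ^ 2 :=
      contDiff_const.sub ((contDiff_id.sub contDiff_const).norm_sq ℝ)
    rw [lap_mul h1.contDiffAt contDiffAt_const, lap_const_sub, lap_norm_sub_sq]
    simp [lap]
  have hζ0 : ∀ x ∈ Ω, 0 ≤ ζ x ∧ ζ x ≤ R ^ 2 / 4 := by
    intro x hx
    have h1 : ‖x‖ ≤ R := by simpa using hR hx
    have h2 : ‖x‖ ^ 2 ≤ R ^ 2 := by gcongr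
    simp only [ζ, sub_zero]
    constructor <;> nlinarith [sq_nonneg ‖x‖]
  have hgreen : ∫ x, g x = ∫ x, ζ x * -lap g x := by
    have := integral_mul_lap_eq hζ hg2 hgc
    simp only [hζlap, neg_mul, one_mul, integral_neg] at this
    simp only [mul_neg, integral_neg, this, neg_neg]
  have hpt : ∀ x, ζ x * -lap g x ≤ Ω.indicator (fun x => R ^ 2 / 4 * h x) x := by
    intro x
    by_cases hx : x ∈ Ω
    · rw [Set.indicator_of_mem hx, lap_congr (hg_in x hx), lap_comp hΦ (hwat x hx),
        lap_sub_const]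
      have hs : 0 ≤ ∑ i : Fin 2,
          fderiv ℝ (fun x => w x - 1) x (EuclideanSpace.single i 1) ^ 2 :=
        Finset.sum_nonneg fun i _ => sq_nonneg _
      have h1 := mul_nonneg (hΦ3 (w x - 1)) hs
      have h2 := mul_le_mul_of_nonneg_left (hlap x hx) (hΦ1 (w x - 1))
      have h3 := mul_le_mul_of_nonneg_right (hΦ2 (w x - 1)) (hh x hx)
      obtain ⟨h4, h5⟩ := hζ0 x hx
      calc _ ≤ ζ x * h x := mul_le_mul_of_nonneg_left (by linarith) h4
        _ ≤ _ := mul_le_mul_of_nonneg_right h5 (hh x hx)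
    · rw [Set.indicator_of_notMem hx, lap_congr (hg_out x hx)]
      simp [lap]
  have hgint : Integrable g := hg2.continuous.integrable_of_hasCompactSupport hgc
  have hmass : ∫ x, g x ≤ R ^ 2 / 4 * ∫ x in Ω, h x := by
    rw [hgreen, ← integral_const_mul, ← integral_indicator hΩ.measurableSet]
    refine integral_mono ?_ ((integrable_indicator_iff hΩ.measurableSet).2 (hhi.const_mul _)) hpt
    exact (hζ.continuous.mul (continuous_lap hg2).neg).integrable_of_hasCompactSupport
      (hgc.lap.neg.mul_left)
  have hgΩ : ∫ x in Ω, g x = ∫ x, g x :=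
    setIntegral_eq_integral_of_forall_compl_eq_zero fun x hx => Set.indicator_of_notMem hx _
  have hconst : IntegrableOn (fun _ : Plane => (2 : ℝ)) Ω := integrableOn_const hΩfin
  calc ∫ x in Ω, max (w x) 0 ≤ ∫ x in Ω, (g x + 2) := by
        refine integral_mono_of_nonneg (ae_of_all _ fun x => le_max_right _ _)
          (hgint.integrableOn.add hconst) ?_
        filter_upwards [ae_restrict_mem hΩ.measurableSet] with x hx
        simp only [g, Set.indicator_of_mem hx]
        have h1 := hΦ5 (w x - 1)
        have h2 := hΦ4 (w x - 1)
        exact max_le (by linarith) (by linarith)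
    _ = (∫ x, g x) + 2 * volume.real Ω := by
        rw [integral_add hgint.integrableOn hconst, hgΩ]
        simp [mul_comm]
    _ ≤ _ := by linarith

end BoundaryControl

section Kernel

/-- The reciprocal of the regularized squared distance to `x`. -/
noncomputable def regInv (ε : ℝ) (x y : Plane) : ℝ := (‖y - x‖ ^ 2 + ε ^ 2)⁻¹

/-- The regularized gradient, in direction `e`, of the logarithmic kernel centred at `x`. -/
noncomputable def regKernel (ε : ℝ) (x e y : Plane) : ℝ := inner ℝ (x - y) e * regInv ε x y

/-- The approximate identity `ε² / (π (|z|² + ε²)²)` centred at `x`. -/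
noncomputable def approxId (ε : ℝ) (x y : Plane) : ℝ := ε ^ 2 / π * regInv ε x y ^ 2

variable {ε : ℝ}

theorem regInv_denom_pos (hε : 0 < ε) (x y : Plane) : 0 < ‖y - x‖ ^ 2 + ε ^ 2 := by positivity

theorem contDiff_regInv (hε : 0 < ε) (x : Plane) : ContDiff ℝ 2 (regInv ε x) := by
  have : ContDiff ℝ 2 fun y : Plane => ‖y - x‖ ^ 2 + ε ^ 2 :=
    ((contDiff_id.sub contDiff_const).norm_sq ℝ).add contDiff_const
  exact this.inv fun y => (regInv_denom_pos hε x y).ne'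

theorem contDiff_inner_sub (x e : Plane) : ContDiff ℝ 2 fun y : Plane => inner ℝ (x - y) e :=
  (contDiff_const.sub contDiff_id).inner ℝ contDiff_const

theorem contDiff_regKernel (hε : 0 < ε) (x e : Plane) : ContDiff ℝ 2 (regKernel ε x e) :=
  (contDiff_inner_sub x e).mul (contDiff_regInv hε x)

theorem contDiff_approxId (hε : 0 < ε) (x : Plane) : ContDiff ℝ 2 (approxId ε x) :=
  contDiff_const.mul ((contDiff_regInv hε x).pow 2)

theorem fderiv_inner_sub (x e y v : Plane) :
    fderiv ℝ (fun y : Plane => inner ℝ (x - y) e) y v = -inner ℝ v e := by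
  have h := ((hasFDerivAt_id y).const_sub x).inner ℝ (hasFDerivAt_const e y)
  simp only [id] at h
  rw [h.fderiv]
  simp

theorem fderiv_regInv (hε : 0 < ε) (x y v : Plane) :
    fderiv ℝ (regInv ε x) y v = -2 * regInv ε x y ^ 2 * inner ℝ (y - x) v := by
  have hd : DifferentiableAt ℝ (fun y : Plane => ‖y - x‖ ^ 2) y :=
    ((contDiff_id.sub contDiff_const).norm_sq ℝ (n := 1)).differentiable (by norm_num) y
  have h1 := (hd.hasFDerivAt.add_const (ε ^ 2))
  have h2 := (hasDerivAt_inv (regInv_denom_pos hε x y).ne').comp_hasFDerivAt y h1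
  have h3 : HasFDerivAt (regInv ε x) _ y := h2
  rw [h3.fderiv, regInv]
  simp only [smul_apply, fderiv_norm_sub_sq, smul_eq_mul, inv_pow]
  ring

theorem lap_regInv (hε : 0 < ε) (x y : Plane) :
    lap (regInv ε x) y = -4 * regInv ε x y ^ 2 + 8 * ‖y - x‖ ^ 2 * regInv ε x y ^ 3 := by
  have hq := (contDiff_regInv hε x).contDiffAt (x := y)
  have hD : ContDiffAt ℝ 2 (fun y : Plane => ‖y - x‖ ^ 2 - (-ε ^ 2)) y :=
    (((contDiff_id.sub contDiff_const).norm_sq ℝ).sub contDiff_const).contDiffAt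
  have hone : ∀ y, regInv ε x y * (‖y - x‖ ^ 2 - (-ε ^ 2)) = 1 := fun y => by
    have := (regInv_denom_pos hε x y).ne'
    rw [regInv]
    field_simp
    ring
  have h1 := lap_mul hq hD
  have h2 : lap (fun y => regInv ε x y * (‖y - x‖ ^ 2 - (-ε ^ 2))) y = 0 := by
    simp only [hone]
    simp [lap]
  have h3 : ∑ i : Fin 2, fderiv ℝ (regInv ε x) y (EuclideanSpace.single i 1) *
      fderiv ℝ (fun y : Plane => ‖y - x‖ ^ 2 - (-ε ^ 2)) y (EuclideanSpace.single i 1) =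
      -4 * regInv ε x y ^ 2 * ‖y - x‖ ^ 2 := by
    rw [← real_inner_self_eq_norm_sq, ← sum_inner_single_mul, Finset.mul_sum]
    refine Finset.sum_congr rfl fun i _ => ?_
    rw [fderiv_regInv hε, fderiv_sub_const, fderiv_norm_sub_sq]
    ring
  rw [h2, h3, lap_sub_const, lap_norm_sub_sq] at h1
  have h4 := hone y
  set q := regInv ε x y
  set s := ‖y - x‖ ^ 2
  linear_combination (-q) * h1 + (-lap (regInv ε x) y) * h4

theorem lap_inner_sub (x e y : Plane) : lap (fun y : Plane => inner ℝ (x - y) e) y = 0 := by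
  unfold lap
  simp only [fderiv_inner_sub]
  simp

theorem lap_regKernel (hε : 0 < ε) (x e y : Plane) :
    lap (regKernel ε x e) y = -8 * ε ^ 2 * regInv ε x y ^ 3 * inner ℝ (x - y) e := by
  have h1 := lap_mul (contDiff_inner_sub x e).contDiffAt (contDiff_regInv hε x).contDiffAt (x := y)
  have h2 : ∑ i : Fin 2, fderiv ℝ (fun y : Plane => inner ℝ (x - y) e) y
        (EuclideanSpace.single i 1) * fderiv ℝ (regInv ε x) y (EuclideanSpace.single i 1) =
      -2 * regInv ε x y ^ 2 * inner ℝ (x - y) e := by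
    rw [← sum_inner_single_mul, Finset.mul_sum]
    refine Finset.sum_congr rfl fun i _ => ?_
    rw [fderiv_regInv hε, fderiv_inner_sub, ← neg_sub x y, inner_neg_left, real_inner_comm e]
    ring
  have h3 : regInv ε x y * (‖y - x‖ ^ 2 + ε ^ 2) = 1 :=
    inv_mul_cancel₀ (regInv_denom_pos hε x y).ne'
  change lap (fun y => inner ℝ (x - y) e * regInv ε x y) y = _
  rw [h1, h2, lap_inner_sub, lap_regInv hε]
  linear_combination (8 * regInv ε x y ^ 2 * inner ℝ (x - y) e) * h3

theorem fderiv_approxId (hε : 0 < ε) (x e y : Plane) :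
    fderiv ℝ (approxId ε x) y e = 4 * ε ^ 2 / π * regInv ε x y ^ 3 * inner ℝ (x - y) e := by
  have hd := ((contDiff_regInv hε x).differentiable (by norm_num) y).hasFDerivAt
  have h : HasFDerivAt (approxId ε x) _ y := (hd.pow 2).const_mul (ε ^ 2 / π)
  rw [h.fderiv]
  simp only [smul_apply, fderiv_regInv hε, smul_eq_mul, ← neg_sub x y,
    inner_neg_left]
  simp
  ring

theorem lap_regKernel_eq_fderiv (hε : 0 < ε) (x e y : Plane) :
    lap (regKernel ε x e) y = -(2 * π) * fderiv ℝ (approxId ε x) y e := by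
  rw [lap_regKernel hε, fderiv_approxId hε]
  field_simp
  ring

theorem regInv_nonneg (ε : ℝ) (x y : Plane) : 0 ≤ regInv ε x y := by
  unfold regInv; positivity

theorem regInv_mul_sq_le (ε : ℝ) (x y : Plane) : regInv ε x y * ‖x - y‖ ^ 2 ≤ 1 := by
  rw [regInv, norm_sub_rev, inv_mul_eq_div]
  exact div_le_one_of_le₀ (by nlinarith [sq_nonneg ε]) (by positivity)

theorem abs_regKernel_le {d : ℝ} (hd : 0 < d) {x y : Plane} (hxy : d ≤ ‖x - y‖) (e : Plane) :
    |regKernel ε x e y| ≤ ‖e‖ / d := by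
  have h0 := regInv_nonneg ε x y
  have h1 := regInv_mul_sq_le ε x y
  have h2 : regInv ε x y * ‖x - y‖ ≤ 1 / d := by
    rw [le_div_iff₀ hd]
    nlinarith [mul_nonneg h0 (norm_nonneg (x - y))]
  rw [regKernel, abs_mul, abs_of_nonneg h0]
  calc _ ≤ ‖x - y‖ * ‖e‖ * regInv ε x y := by gcongr; exact abs_real_inner_le_norm _ _
    _ = ‖e‖ * (regInv ε x y * ‖x - y‖) := by ring
    _ ≤ ‖e‖ * (1 / d) := by gcongr
    _ = _ := by ring

theorem abs_fderiv_regKernel_le (hε : 0 < ε) {d : ℝ} (hd : 0 < d) {x y : Plane}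
    (hxy : d ≤ ‖x - y‖) (e v : Plane) :
    |fderiv ℝ (regKernel ε x e) y v| ≤ 3 * ‖e‖ * ‖v‖ / d ^ 2 := by
  have h0 := regInv_nonneg ε x y
  have h1 := regInv_mul_sq_le ε x y
  have h2 : regInv ε x y ≤ 1 / d ^ 2 := by
    rw [le_div_iff₀ (by positivity)]
    refine le_trans ?_ h1
    gcongr
  have h3 : fderiv ℝ (regKernel ε x e) y v = -inner ℝ v e * regInv ε x y +
      2 * regInv ε x y ^ 2 * inner ℝ (x - y) v * inner ℝ (x - y) e := by
    have ha := (contDiff_inner_sub x e).differentiable (by norm_num) y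
    have hb := (contDiff_regInv hε x).differentiable (by norm_num) y
    change fderiv ℝ (fun y => inner ℝ (x - y) e * regInv ε x y) y v = _
    rw [fderiv_fun_mul ha hb]
    simp only [add_apply, smul_apply, fderiv_regInv hε,
      fderiv_inner_sub, smul_eq_mul, ← neg_sub x y, inner_neg_left]
    ring
  rw [h3]
  have h4 : |(-inner ℝ v e * regInv ε x y : ℝ)| ≤ ‖v‖ * ‖e‖ * regInv ε x y := by
    rw [abs_mul, abs_neg, abs_of_nonneg h0]
    gcongr
    exact abs_real_inner_le_norm _ _
  have h5 : |2 * regInv ε x y ^ 2 * inner ℝ (x - y) v * inner ℝ (x - y) e| ≤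
      2 * regInv ε x y ^ 2 * (‖x - y‖ * ‖v‖) * (‖x - y‖ * ‖e‖) := by
    rw [abs_mul, abs_mul, abs_of_nonneg (by positivity : 0 ≤ 2 * regInv ε x y ^ 2)]
    gcongr <;> exact abs_real_inner_le_norm _ _
  calc _ ≤ ‖v‖ * ‖e‖ * regInv ε x y +
        2 * regInv ε x y ^ 2 * (‖x - y‖ * ‖v‖) * (‖x - y‖ * ‖e‖) :=
        (abs_add_le _ _).trans (add_le_add h4 h5)
    _ = ‖v‖ * ‖e‖ * regInv ε x y * (1 + 2 * (regInv ε x y * ‖x - y‖ ^ 2)) := by ring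
    _ ≤ ‖v‖ * ‖e‖ * (1 / d ^ 2) * (1 + 2 * 1) := by gcongr
    _ = _ := by ring

theorem integral_approxId_one : ∫ z : Plane, approxId 1 0 z = 1 := by
  have h := integral_fun_norm_addHaar (volume : Measure Plane)
    (fun r : ℝ => 1 / π * ((r ^ 2 + 1)⁻¹) ^ 2)
  have hI : ∫ r in Set.Ioi (0 : ℝ), r ^ (2 - 1) • (1 / π * ((r ^ 2 + 1)⁻¹) ^ 2) = 1 / (2 * π) := by
    have hd : ∀ r ∈ Set.Ici (0 : ℝ), HasDerivAt (fun r : ℝ => -(1 / (2 * π)) * (r ^ 2 + 1)⁻¹)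
        (r ^ (2 - 1) • (1 / π * ((r ^ 2 + 1)⁻¹) ^ 2)) r := by
      intro r _
      have hp : r ^ 2 + 1 ≠ 0 := by positivity
      have := ((((hasDerivAt_id r).fun_pow 2).add_const 1).inv hp).const_mul (-(1 / (2 * π)))
      refine this.congr_deriv ?_
      simp
      field_simp
    have ht : Tendsto (fun r : ℝ => -(1 / (2 * π)) * (r ^ 2 + 1)⁻¹) atTop (𝓝 0) := by
      have h1 : Tendsto (fun r : ℝ => r ^ 2 + 1) atTop atTop :=
        tendsto_atTop_add_const_right _ _ (tendsto_pow_atTop two_ne_zero)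
      simpa using (tendsto_inv_atTop_zero.comp h1).const_mul (-(1 / (2 * π)))
    rw [integral_Ioi_of_hasDerivAt_of_nonneg' hd ?_ ht]
    · simp
    · intro r hr
      have : (0 : ℝ) < r := hr
      simp only [smul_eq_mul]
      positivity
  simp only [finrank_euclideanSpace, Fintype.card_fin, hI] at h
  have hv : volume.real (ball (0 : Plane) 1) = π := by
    simp [Measure.real, EuclideanSpace.volume_ball_fin_two, pi_pos.le]
  rw [hv] at h
  simp only [approxId, regInv, one_pow, sub_zero]
  rw [h]
  simp

theorem integrable_approxId_one : Integrable fun z : Plane => approxId 1 0 z :=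
  Integrable.of_integral_ne_zero (by rw [integral_approxId_one]; exact one_ne_zero)

end Kernel

section Limits

theorem approxId_nonneg (ε : ℝ) (x y : Plane) : 0 ≤ approxId ε x y := by
  unfold approxId; positivity

theorem integral_approxId_mul {ε : ℝ} (hε : 0 < ε) (x : Plane) (G : Plane → ℝ) :
    ∫ y, approxId ε x y * G y = ∫ z, approxId 1 0 z * G (x - ε • z) := by
  have h1 := integral_sub_left_eq_self (fun y => approxId ε x y * G y) volume x
  have h2 := Measure.integral_comp_smul volume (fun z => approxId ε x (x - z) * G (x - z)) ε
  rw [h1] at h2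
  have hd : Module.finrank ℝ Plane = 2 := by simp
  rw [hd, abs_of_pos (by positivity), smul_eq_mul, eq_comm, inv_mul_eq_iff_eq_mul₀ (by positivity),
    ← integral_const_mul] at h2
  rw [h2]
  congr 1
  funext z
  have : approxId 1 0 z = ε ^ 2 * approxId ε x (x - ε • z) := by
    have hp : ‖z‖ ^ 2 + 1 ≠ 0 := by positivity
    simp only [approxId, regInv, sub_zero, sub_sub_cancel_left, norm_neg, norm_smul,
      Real.norm_of_nonneg hε.le]
    rw [show (ε * ‖z‖) ^ 2 + ε ^ 2 = ε ^ 2 * (‖z‖ ^ 2 + 1) by ring]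
    field_simp
  rw [this]
  ring

theorem abs_integral_approxId_mul_le {ε : ℝ} (hε : 0 < ε) (x : Plane) {G : Plane → ℝ} {B : ℝ}
    (hB : ∀ y, |G y| ≤ B) : |∫ y, approxId ε x y * G y| ≤ B := by
  rw [integral_approxId_mul hε]
  have h := norm_integral_le_of_norm_le (μ := volume)
    (f := fun z => approxId 1 0 z * G (x - ε • z)) (integrable_approxId_one.mul_const B)
    (ae_of_all _ fun z => by
      rw [norm_mul, Real.norm_of_nonneg (approxId_nonneg _ _ _), Real.norm_eq_abs]
      exact mul_le_mul_of_nonneg_left (hB _) (approxId_nonneg _ _ _))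
  rwa [integral_mul_const, integral_approxId_one, one_mul, Real.norm_eq_abs] at h

theorem continuous_approxId_one : Continuous (approxId 1 0) :=
  (contDiff_approxId one_pos 0).continuous

theorem tendsto_integral_approxId_mul (x : Plane) {G : Plane → ℝ} (hG : Continuous G) {B : ℝ}
    (hB : ∀ y, |G y| ≤ B) :
    Tendsto (fun ε => ∫ y, approxId ε x y * G y) (𝓝[>] 0) (𝓝 (G x)) := by
  have h : Tendsto (fun ε : ℝ => ∫ z, approxId 1 0 z * G (x - ε • z)) (𝓝[>] 0)
      (𝓝 (∫ z, approxId 1 0 z * G x)) := by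
    refine tendsto_integral_filter_of_dominated_convergence (fun z => approxId 1 0 z * B)
      ?_ ?_ (integrable_approxId_one.mul_const B) ?_
    · exact Eventually.of_forall fun ε => (continuous_approxId_one.mul
        (hG.comp (by fun_prop))).aestronglyMeasurable
    · refine Eventually.of_forall fun ε => ae_of_all _ fun z => ?_
      rw [norm_mul, Real.norm_of_nonneg (approxId_nonneg _ _ _), Real.norm_eq_abs]
      exact mul_le_mul_of_nonneg_left (hB _) (approxId_nonneg _ _ _)
    · refine ae_of_all _ fun z => ?_
      have hc : Continuous fun ε : ℝ => approxId 1 0 z * G (x - ε • z) :=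
        continuous_const.mul (hG.comp (by fun_prop))
      have := hc.tendsto 0
      simp only [zero_smul, sub_zero] at this
      exact this.mono_left nhdsWithin_le_nhds
  rw [integral_mul_const, integral_approxId_one, one_mul] at h
  refine h.congr' ?_
  filter_upwards [self_mem_nhdsWithin] with ε hε
  exact (integral_approxId_mul hε x G).symm

theorem continuous_regInv_prod {ε : ℝ} (hε : 0 < ε) :
    Continuous fun p : Plane × Plane => regInv ε p.1 p.2 := by
  unfold regInv
  exact Continuous.inv₀ (by fun_prop) fun p => (regInv_denom_pos hε p.1 p.2).ne'

theorem tendsto_integral_mul_integral_approxId {F : Plane → ℝ} (hF : Continuous F)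
    (hFi : Integrable F) {G : Plane → Plane → ℝ} (hG : Continuous fun p : Plane × Plane => G p.1 p.2)
    {B : ℝ} (hB : ∀ x y, |G x y| ≤ B) :
    Tendsto (fun ε => ∫ x, F x * ∫ y, approxId ε x y * G x y) (𝓝[>] 0)
      (𝓝 (∫ x, F x * G x x)) := by
  refine tendsto_integral_filter_of_dominated_convergence (fun x => |F x| * B)
      ?_ ?_ (hFi.abs.mul_const B) ?_
  · filter_upwards [self_mem_nhdsWithin] with ε hε
    have hc : Continuous fun p : Plane × Plane => approxId ε p.1 p.2 * G p.1 p.2 :=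
      (continuous_const.mul ((continuous_regInv_prod hε).pow 2)).mul hG
    have hm : StronglyMeasurable fun x => ∫ y, approxId ε x y * G x y :=
      hc.stronglyMeasurable.integral_prod_right
    exact (hF.stronglyMeasurable.mul hm).aestronglyMeasurable
  · filter_upwards [self_mem_nhdsWithin] with ε hε
    refine ae_of_all _ fun x => ?_
    rw [norm_mul, Real.norm_eq_abs, Real.norm_eq_abs]
    exact mul_le_mul_of_nonneg_left (abs_integral_approxId_mul_le hε x (hB x)) (abs_nonneg _)
  · refine ae_of_all _ fun x => Tendsto.const_mul _ ?_
    exact tendsto_integral_approxId_mul x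
      (hG.comp (continuous_const.prodMk continuous_id)) (hB x)

/-- The symmetrized interaction kernel of a vector field `X`. -/
noncomputable def symKernel (ε : ℝ) (X : Plane → Plane) (p : Plane × Plane) : ℝ :=
  inner ℝ (p.1 - p.2) (X p.1 - X p.2) * regInv ε p.1 p.2

theorem abs_symKernel_le {X : Plane → Plane} {M : ℝ} (hM : ∀ x y, ‖X x - X y‖ ≤ M * ‖x - y‖)
    (ε : ℝ) (p : Plane × Plane) : |symKernel ε X p| ≤ M := by
  have hM0 : 0 ≤ M := by
    have h := hM (EuclideanSpace.single 0 1) 0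
    simp only [sub_zero, PiLp.norm_single, norm_one, mul_one] at h
    exact (norm_nonneg _).trans h
  have h0 := regInv_nonneg ε p.1 p.2
  rw [symKernel, abs_mul, abs_of_nonneg h0]
  calc _ ≤ ‖p.1 - p.2‖ * (M * ‖p.1 - p.2‖) * regInv ε p.1 p.2 := by
        gcongr
        exact (abs_real_inner_le_norm _ _).trans (by gcongr; exact hM _ _)
    _ = M * (regInv ε p.1 p.2 * ‖p.1 - p.2‖ ^ 2) := by ring
    _ ≤ M * 1 := by gcongr; exact regInv_mul_sq_le ε _ _
    _ = M := mul_one M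

theorem ae_prod_fst_ne_snd : ∀ᵐ p : Plane × Plane, p.1 ≠ p.2 := by
  have hm : MeasurableSet {p : Plane × Plane | p.1 = p.2} :=
    (isClosed_eq continuous_fst continuous_snd).measurableSet
  have h : (volume.prod volume) {p : Plane × Plane | p.1 = p.2} = 0 := by
    rw [Measure.measure_prod_null hm]
    refine ae_of_all _ fun x => ?_
    have : Prod.mk x ⁻¹' {p : Plane × Plane | p.1 = p.2} = {x} := by
      ext y; simp [eq_comm]
    simp [this]
  exact measure_eq_zero_iff_ae_notMem.1 h

theorem hasCompactSupport_mul_prod {F : Plane → ℝ} (hFc : HasCompactSupport F) :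
    HasCompactSupport fun p : Plane × Plane => F p.1 * F p.2 := by
  refine HasCompactSupport.intro (hFc.isCompact.prod hFc.isCompact) fun p hp => ?_
  by_cases h : p.1 ∈ tsupport F
  · rw [image_eq_zero_of_notMem_tsupport fun h2 => hp ⟨h, h2⟩, mul_zero]
  · rw [image_eq_zero_of_notMem_tsupport h, zero_mul]

theorem integral_regKernel_eq_symKernel {F : Plane → ℝ} (hF : Continuous F)
    (hFc : HasCompactSupport F) {X : Plane → Plane} (hX : Continuous X) {ε : ℝ} (hε : 0 < ε) :
    ∫ x, F x * ∫ y, F y * regKernel ε x (X x) y =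
      1 / 2 * ∫ p : Plane × Plane, F p.1 * F p.2 * symKernel ε X p := by
  set T : Plane × Plane → ℝ := fun p => F p.1 * F p.2 * regKernel ε p.1 (X p.1) p.2
  have hTc : Continuous T := by
    refine Continuous.mul (by fun_prop) ?_
    exact Continuous.mul (by fun_prop) (continuous_regInv_prod hε)
  have hTi : Integrable T (volume.prod volume) :=
    hTc.integrable_of_hasCompactSupport (hasCompactSupport_mul_prod hFc).mul_right
  have h1 : ∫ x, F x * ∫ y, F y * regKernel ε x (X x) y = ∫ p, T p ∂volume.prod volume := by
    rw [integral_prod _ hTi]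
    simp only [T, mul_assoc, integral_const_mul]
  have h2 : ∫ p, T p.swap ∂volume.prod volume = ∫ p, T p ∂volume.prod volume :=
    integral_prod_swap T
  have h3 : ∀ p : Plane × Plane, F p.1 * F p.2 * symKernel ε X p = T p + T p.swap := by
    intro p
    simp only [T, symKernel, regKernel, Prod.fst_swap, Prod.snd_swap, inner_sub_right]
    rw [show regInv ε p.2 p.1 = regInv ε p.1 p.2 by simp only [regInv, norm_sub_rev],
      ← neg_sub p.1 p.2, inner_neg_left]
    ring
  have hsw : Integrable (fun p => T p.swap) (volume.prod volume) := hTi.swap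
  simp only [h3]
  rw [Measure.volume_eq_prod, integral_add hTi hsw, h2, h1]
  ring

theorem tendsto_integral_regKernel {F : Plane → ℝ} (hF : Continuous F)
    (hFc : HasCompactSupport F) {X : Plane → Plane} (hX : Continuous X) {M : ℝ}
    (hM : ∀ x y, ‖X x - X y‖ ≤ M * ‖x - y‖) :
    Tendsto (fun ε => ∫ x, F x * ∫ y, F y * regKernel ε x (X x) y) (𝓝[>] 0)
      (𝓝 (1 / 2 * ∫ p : Plane × Plane, F p.1 * F p.2 * symKernel 0 X p)) := by
  have hFF : Continuous fun p : Plane × Plane => F p.1 * F p.2 := by fun_prop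
  have hFFi := hFF.integrable_of_hasCompactSupport (hasCompactSupport_mul_prod hFc)
    (μ := (volume : Measure (Plane × Plane)))
  have h : Tendsto (fun ε => ∫ p : Plane × Plane, F p.1 * F p.2 * symKernel ε X p) (𝓝[>] 0)
      (𝓝 (∫ p : Plane × Plane, F p.1 * F p.2 * symKernel 0 X p)) := by
    refine tendsto_integral_filter_of_dominated_convergence (fun p => |F p.1 * F p.2| * M)
      ?_ ?_ (hFFi.abs.mul_const M) ?_
    · filter_upwards [self_mem_nhdsWithin] with ε hε
      exact (hFF.mul (Continuous.mul (by fun_prop)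
        (continuous_regInv_prod hε))).aestronglyMeasurable
    · refine Eventually.of_forall fun ε => ae_of_all _ fun p => ?_
      rw [norm_mul, Real.norm_eq_abs, Real.norm_eq_abs]
      exact mul_le_mul_of_nonneg_left (abs_symKernel_le hM ε p) (abs_nonneg _)
    · refine ae_of_all _ fun p => Tendsto.const_mul _ ?_
      by_cases hp : p.2 - p.1 = 0
      · have : ∀ ε, symKernel ε X p = 0 := fun ε => by
          simp [symKernel, (sub_eq_zero.1 hp)]
        simp only [this]
        exact tendsto_const_nhds
      · have hc : ContinuousAt (fun ε : ℝ => symKernel ε X p) 0 := by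
          unfold symKernel regInv
          refine continuousAt_const.mul (ContinuousAt.inv₀ (by fun_prop) ?_)
          have := norm_pos_iff.2 hp
          positivity
        exact hc.tendsto.mono_left nhdsWithin_le_nhds
  refine (h.const_mul (1 / 2)).congr' ?_
  filter_upwards [self_mem_nhdsWithin] with ε hε
  exact (integral_regKernel_eq_symKernel hF hFc hX hε).symm

/-- If `X` is the radial field near `c`, the limiting interaction energy of `F` is the square of
its total mass, up to the first moment of `F` about `c`. -/
theorem abs_integral_symKernel_sub_sq_le {F : Plane → ℝ} (hF : Continuous F)
    (hFc : HasCompactSupport F) (hF0 : ∀ x, 0 ≤ F x) {X : Plane → Plane} (hX : Continuous X)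
    {M : ℝ} (hM : ∀ x y, ‖X x - X y‖ ≤ M * ‖x - y‖) {c : Plane} {r : ℝ} (hr : 0 < r)
    (hXc : ∀ x, ‖x - c‖ ≤ r → X x = x - c) :
    |(∫ p : Plane × Plane, F p.1 * F p.2 * symKernel 0 X p) - (∫ x, F x) ^ 2| ≤
      2 * (1 + M) / r * ((∫ x, F x) * ∫ x, F x * ‖x - c‖) := by
  have hM0 : 0 ≤ M := (abs_nonneg _).trans (abs_symKernel_le hM 0 (0, 0))
  have hFi : Integrable F := hF.integrable_of_hasCompactSupport hFc
  have hFmi : Integrable fun x => F x * ‖x - c‖ :=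
    (Continuous.mul hF (by fun_prop)).integrable_of_hasCompactSupport hFc.mul_right
  have hFF : Continuous fun p : Plane × Plane => F p.1 * F p.2 := by fun_prop
  have hFFi := hFF.integrable_of_hasCompactSupport (hasCompactSupport_mul_prod hFc)
    (μ := (volume : Measure (Plane × Plane)))
  have hSm : Measurable (symKernel 0 X) := by
    unfold symKernel regInv
    exact (Continuous.measurable (by fun_prop)).mul (Continuous.measurable (by fun_prop)).inv
  have hSi : Integrable fun p : Plane × Plane => F p.1 * F p.2 * symKernel 0 X p :=
    hFFi.mul_bdd (c := M) hSm.aestronglyMeasurable (ae_of_all _ fun p => abs_symKernel_le hM 0 p)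
  have hsq : (∫ x, F x) ^ 2 = ∫ p : Plane × Plane, F p.1 * F p.2 := by
    rw [Measure.volume_eq_prod, integral_prod_mul, sq]
  have hb1 : Integrable fun p : Plane × Plane => F p.1 * (F p.2 * ‖p.2 - c‖) := hFi.mul_prod hFmi
  have hb2 : Integrable fun p : Plane × Plane => F p.1 * ‖p.1 - c‖ * F p.2 := hFmi.mul_prod hFi
  have hbound : ∫ p : Plane × Plane, (1 + M) / r *
      (F p.1 * (F p.2 * ‖p.2 - c‖) + F p.1 * ‖p.1 - c‖ * F p.2) =
      2 * (1 + M) / r * ((∫ x, F x) * ∫ x, F x * ‖x - c‖) := by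
    rw [integral_const_mul, integral_add hb1 hb2, Measure.volume_eq_prod,
      integral_prod_mul F fun x => F x * ‖x - c‖, integral_prod_mul (fun x => F x * ‖x - c‖) F]
    ring
  rw [hsq, ← integral_sub hSi hFFi, ← hbound, ← Real.norm_eq_abs]
  refine norm_integral_le_of_norm_le ((hb1.add hb2).const_mul _) ?_
  filter_upwards [ae_prod_fst_ne_snd] with p hp
  have h0 : 0 ≤ F p.1 * F p.2 := mul_nonneg (hF0 _) (hF0 _)
  have hkey : |symKernel 0 X p - 1| ≤ (1 + M) / r * (‖p.2 - c‖ + ‖p.1 - c‖) := by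
    by_cases hnear : ‖p.1 - c‖ ≤ r ∧ ‖p.2 - c‖ ≤ r
    · have hne : ‖p.1 - p.2‖ ≠ 0 := norm_ne_zero_iff.2 (sub_ne_zero.2 hp)
      have : symKernel 0 X p = 1 := by
        rw [symKernel, hXc _ hnear.1, hXc _ hnear.2, sub_sub_sub_cancel_right,
          real_inner_self_eq_norm_sq, regInv, norm_sub_rev p.2]
        field_simp
        simp
      rw [this, sub_self, abs_zero]
      positivity
    · have h1 : r ≤ ‖p.2 - c‖ + ‖p.1 - c‖ := by
        by_contra! h
        exact hnear ⟨by linarith [norm_nonneg (p.2 - c)], by linarith [norm_nonneg (p.1 - c)]⟩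
      have h2 := abs_symKernel_le hM 0 p
      calc _ ≤ |symKernel 0 X p| + |1| := abs_sub _ _
        _ ≤ (1 + M) / r * r := by rw [div_mul_cancel₀ _ hr.ne', abs_one]; linarith
        _ ≤ _ := by gcongr
  calc ‖F p.1 * F p.2 * symKernel 0 X p - F p.1 * F p.2‖
      = F p.1 * F p.2 * |symKernel 0 X p - 1| := by
        rw [Real.norm_eq_abs, ← abs_of_nonneg h0, ← abs_mul, abs_of_nonneg h0, mul_sub, mul_one]
    _ ≤ F p.1 * F p.2 * ((1 + M) / r * (‖p.2 - c‖ + ‖p.1 - c‖)) := by gcongr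
    _ = _ := by ring

end Limits

section Localization

variable {c : Plane} {r : ℝ} {ψ : Plane → ℝ}

theorem exists_abs_lap_fderiv_le (hψ : ContDiff ℝ 2 ψ) (hψc : HasCompactSupport ψ) :
    ∃ A, 0 ≤ A ∧ (∀ y, |lap ψ y| ≤ A) ∧
      ∀ y (i : Fin 2), |fderiv ℝ ψ y (EuclideanSpace.single i 1)| ≤ A := by
  obtain ⟨A₁, hA₁⟩ := (continuous_lap hψ).bounded_above_of_compact_support hψc.lap
  obtain ⟨A₂, hA₂⟩ := (hψ.continuous_fderiv (by norm_num)).bounded_above_of_compact_support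
    (hψc.fderiv (𝕜 := ℝ))
  refine ⟨max A₁ A₂, ((norm_nonneg _).trans (hA₁ 0)).trans (le_max_left _ _),
    fun y => (hA₁ y).trans (le_max_left _ _), fun y i => ?_⟩
  have h := (fderiv ℝ ψ y).le_opNorm (EuclideanSpace.single i 1)
  rw [PiLp.norm_single, norm_one, mul_one] at h
  exact (h.trans (hA₂ y)).trans (le_max_right _ _)

/-- Localized Green identity against the regularized kernel: far from the singularity the cutoff
contributes an error controlled by the `L¹` norm of `v`. -/
theorem exists_abs_integral_regKernel_mul_lap_sub_le (hr : 0 < r) (hψ : ContDiff ℝ 2 ψ)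
    (hψc : HasCompactSupport ψ) (hψ1 : ∀ y, ‖y - c‖ < 3 * r → ψ y = 1)
    (hψ0 : tsupport ψ ⊆ closedBall c (4 * r)) :
    ∃ A, 0 ≤ A ∧ ∀ v : Plane → ℝ, ContDiff ℝ 2 v → ∀ ε, 0 < ε → ∀ x, ‖x - c‖ ≤ 2 * r → ∀ e,
      |(∫ y, ψ y * regKernel ε x e y * lap v y) -
        2 * π * ∫ y, approxId ε x y * fderiv ℝ (fun z => ψ z * v z) y e| ≤
        A * ‖e‖ * ∫ y in closedBall c (4 * r), |v y| := by
  obtain ⟨A, hA0, hA1, hA2⟩ := exists_abs_lap_fderiv_le hψ hψc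
  refine ⟨A * (1 / r + 12 / r ^ 2), by positivity, fun v hv ε hε x hx e => ?_⟩
  have hk := contDiff_regKernel hε x e
  have hψk : HasCompactSupport fun y => ψ y * regKernel ε x e y := hψc.mul_right
  have hψv : ContDiff ℝ 1 fun y => ψ y * v y := (hψ.mul hv).of_le (by norm_num)
  have hψvc : HasCompactSupport fun y => ψ y * v y := hψc.mul_right
  have h1 : ∫ y, v y * lap (fun z => ψ z * regKernel ε x e z) y =
      ∫ y, lap v y * (ψ y * regKernel ε x e y) := integral_mul_lap_eq hv (hψ.mul hk) hψk
  have h2 := integral_mul_fderiv_eq_neg ((contDiff_approxId hε x).of_le (by norm_num)) hψv hψvc e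
  set rem : Plane → ℝ := fun y => v y * (regKernel ε x e y * lap ψ y +
    2 * ∑ i : Fin 2, fderiv ℝ ψ y (EuclideanSpace.single i 1) *
      fderiv ℝ (regKernel ε x e) y (EuclideanSpace.single i 1)) with hrem
  have hpt : ∀ y, v y * lap (fun z => ψ z * regKernel ε x e z) y =
      -(2 * π) * (fderiv ℝ (approxId ε x) y e * (ψ y * v y)) + rem y := fun y => by
    rw [lap_mul hψ.contDiffAt hk.contDiffAt, lap_regKernel_eq_fderiv hε, hrem]
    ring
  have hi1 : Integrable fun y => v y * lap (fun z => ψ z * regKernel ε x e z) y :=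
    (hv.continuous.mul (continuous_lap (hψ.mul hk))).integrable_of_hasCompactSupport
      hψk.lap.mul_left
  have hi2 : Integrable fun y => -(2 * π) * (fderiv ℝ (approxId ε x) y e * (ψ y * v y)) := by
    refine (Continuous.mul (((contDiff_approxId hε x).continuous_fderiv (by norm_num)).clm_apply
      continuous_const) hψv.continuous).integrable_of_hasCompactSupport
      hψvc.mul_left |>.const_mul _
  have hi3 : Integrable rem := by
    have : rem = fun y => v y * lap (fun z => ψ z * regKernel ε x e z) y -
        -(2 * π) * (fderiv ℝ (approxId ε x) y e * (ψ y * v y)) := by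
      funext y; rw [hpt]; ring
    rw [this]
    exact hi1.sub hi2
  have heq : (∫ y, ψ y * regKernel ε x e y * lap v y) -
      2 * π * ∫ y, approxId ε x y * fderiv ℝ (fun z => ψ z * v z) y e = ∫ y, rem y := by
    simp only [mul_comm (lap v _)] at h1
    rw [← h1, h2]
    simp only [hpt]
    rw [integral_add hi2 hi3, integral_const_mul]
    ring
  have hzero : ∀ y, y ∉ closedBall c (4 * r) → rem y = 0 := fun y hy => by
    have hy' : y ∉ tsupport ψ := fun h => hy (hψ0 h)
    have : fderiv ℝ ψ y = 0 := image_eq_zero_of_notMem_tsupport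
      fun h => hy' (tsupport_fderiv_subset ℝ h)
    simp [hrem, this, lap_eq_zero_of_notMem_tsupport hy']
  have hbd : ∀ y, ‖rem y‖ ≤ A * (1 / r + 12 / r ^ 2) * ‖e‖ * |v y| := fun y => by
    by_cases hy : ‖y - c‖ < 3 * r
    · have hloc : ψ =ᶠ[𝓝 y] fun _ => 1 := by
        have : {z : Plane | ‖z - c‖ < 3 * r} ∈ 𝓝 y :=
          (isOpen_lt (by fun_prop) continuous_const).mem_nhds hy
        filter_upwards [this] with z hz using hψ1 z hz
      have h0 : rem y = 0 := by
        have : lap ψ y = 0 := by rw [lap_congr hloc]; simp [lap]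
        simp [hrem, hloc.fderiv_eq, this]
      rw [h0, norm_zero]
      positivity
    · have hxy : r ≤ ‖x - y‖ := by
        have := norm_sub_le_norm_sub_add_norm_sub y x c
        rw [norm_sub_rev y x] at this
        linarith
      have hs : |∑ i : Fin 2, fderiv ℝ ψ y (EuclideanSpace.single i 1) *
          fderiv ℝ (regKernel ε x e) y (EuclideanSpace.single i 1)| ≤
          2 * (A * (3 * ‖e‖ / r ^ 2)) := by
        refine (Finset.abs_sum_le_sum_abs _ _).trans ?_
        refine (Finset.sum_le_card_nsmul _ _ (A * (3 * ‖e‖ / r ^ 2)) fun i _ => ?_).trans ?_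
        · rw [abs_mul]
          have := abs_fderiv_regKernel_le hε hr hxy e (EuclideanSpace.single i 1)
          rw [PiLp.norm_single, norm_one, mul_one] at this
          exact mul_le_mul (hA2 y i) this (abs_nonneg _) hA0
        · simp
      rw [hrem, Real.norm_eq_abs, abs_mul, mul_comm]
      gcongr
      calc _ ≤ |regKernel ε x e y * lap ψ y| + |2 * _| := abs_add_le _ _
        _ ≤ ‖e‖ / r * A + 2 * (2 * (A * (3 * ‖e‖ / r ^ 2))) := by
          rw [abs_mul, abs_mul, abs_two]
          gcongr
          · exact abs_regKernel_le hr hxy e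
          · exact hA1 y
        _ = _ := by ring
  rw [heq, ← setIntegral_eq_integral_of_forall_compl_eq_zero hzero, ← integral_const_mul,
    ← Real.norm_eq_abs]
  refine norm_integral_le_of_norm_le ?_ (ae_of_all _ hbd)
  exact ((hv.continuous.abs.continuousOn).integrableOn_compact
    (isCompact_closedBall _ _)).const_mul _

/-- The interaction energy of the localized mass `F = -ψ Δv` along a vector field `X` supported
where `ψ = 1` is computed by the transport term `∫ F dv(X)`. -/
theorem exists_abs_integral_symKernel_add_le (hr : 0 < r) (hψ : ContDiff ℝ 2 ψ)
    (hψc : HasCompactSupport ψ) (hψ1 : ∀ y, ‖y - c‖ < 3 * r → ψ y = 1)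
    (hψ0 : tsupport ψ ⊆ closedBall c (4 * r)) {X : Plane → Plane} (hX : Continuous X) {M : ℝ}
    (hM : ∀ x y, ‖X x - X y‖ ≤ M * ‖x - y‖) (hX0 : ∀ x, 2 * r < ‖x - c‖ → X x = 0)
    (hXle : ∀ x, ‖X x‖ ≤ ‖x - c‖) :
    ∃ A, 0 ≤ A ∧ ∀ v : Plane → ℝ, ContDiff ℝ 2 v → (∀ x, 0 ≤ -(ψ x * lap v x)) →
      |1 / 2 * (∫ p : Plane × Plane, -(ψ p.1 * lap v p.1) * -(ψ p.2 * lap v p.2) *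
          symKernel 0 X p) + 2 * π * ∫ x, -(ψ x * lap v x) * fderiv ℝ v x (X x)| ≤
        A * (∫ y in closedBall c (4 * r), |v y|) * ∫ x, -(ψ x * lap v x) * ‖x - c‖ := by
  obtain ⟨A, hA0, hA⟩ := exists_abs_integral_regKernel_mul_lap_sub_le hr hψ hψc hψ1 hψ0
  refine ⟨A, hA0, fun v hv hF0 => ?_⟩
  set F : Plane → ℝ := fun x => -(ψ x * lap v x) with hF
  have hFcont : Continuous F := (hψ.continuous.mul (continuous_lap hv)).neg
  have hFc : HasCompactSupport F := (hψc.mul_right (f' := lap v)).neg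
  have hFi : Integrable F := hFcont.integrable_of_hasCompactSupport hFc
  have hFmi : Integrable fun x => F x * ‖x - c‖ :=
    (Continuous.mul hFcont (by fun_prop)).integrable_of_hasCompactSupport hFc.mul_right
  have hψv : ContDiff ℝ 1 fun y => ψ y * v y := (hψ.mul hv).of_le (by norm_num)
  have hψvc : HasCompactSupport fun y => ψ y * v y := hψc.mul_right
  have hdψv : Continuous (fderiv ℝ fun y => ψ y * v y) := hψv.continuous_fderiv (by norm_num)
  set G : Plane → Plane → ℝ := fun x y => fderiv ℝ (fun z => ψ z * v z) y (X x) with hG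
  have hGc : Continuous fun p : Plane × Plane => G p.1 p.2 :=
    (hdψv.comp continuous_snd).clm_apply (hX.comp continuous_fst)
  have hXb : ∀ x, ‖X x‖ ≤ 2 * r := fun x => by
    by_cases h : 2 * r < ‖x - c‖
    · rw [hX0 x h, norm_zero]; positivity
    · exact (hXle x).trans (not_lt.1 h)
  obtain ⟨D, hD⟩ := hdψv.bounded_above_of_compact_support (hψvc.fderiv (𝕜 := ℝ))
  have hGb : ∀ x y, |G x y| ≤ D * (2 * r) := fun x y =>
    ((fderiv ℝ (fun z => ψ z * v z) y).le_opNorm (X x)).trans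
      (mul_le_mul (hD y) (hXb x) (norm_nonneg _) ((norm_nonneg _).trans (hD y)))
  have hGd : ∀ x, G x x = fderiv ℝ v x (X x) := fun x => by
    by_cases h : 2 * r < ‖x - c‖
    · simp [hG, hX0 x h]
    · have hloc : (fun z => ψ z * v z) =ᶠ[𝓝 x] v := by
        have : {z : Plane | ‖z - c‖ < 3 * r} ∈ 𝓝 x :=
          (isOpen_lt (by fun_prop) continuous_const).mem_nhds
            (show ‖x - c‖ < 3 * r by linarith)
        filter_upwards [this] with z hz
        rw [hψ1 z hz, one_mul]
      simp only [hG, hloc.fderiv_eq]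
  have hT1 := tendsto_integral_regKernel hFcont hFc hX hM
  have hT2 := (tendsto_integral_mul_integral_approxId hFcont hFi hGc hGb).const_mul (2 * π)
  simp only [hGd] at hT2
  refine le_of_tendsto (hT1.add hT2).abs ?_
  filter_upwards [self_mem_nhdsWithin] with ε hε
  have hI1 : Integrable fun x => F x * ∫ y, F y * regKernel ε x (X x) y := by
    have hc : Continuous fun p : Plane × Plane => F p.1 * F p.2 * regKernel ε p.1 (X p.1) p.2 := by
      refine Continuous.mul (by fun_prop) ?_
      exact Continuous.mul (by fun_prop) (continuous_regInv_prod hε)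
    have hi : Integrable (fun p : Plane × Plane => F p.1 * F p.2 * regKernel ε p.1 (X p.1) p.2)
        (volume.prod volume) :=
      hc.integrable_of_hasCompactSupport (hasCompactSupport_mul_prod hFc).mul_right
    have := hi.integral_prod_left
    simpa only [mul_assoc, integral_const_mul] using this
  have hI2 : Integrable fun x => F x * ∫ y, approxId ε x y * G x y := by
    have hc : Continuous fun p : Plane × Plane => approxId ε p.1 p.2 * G p.1 p.2 :=
      (continuous_const.mul ((continuous_regInv_prod hε).pow 2)).mul hGc
    exact hFi.mul_bdd (c := D * (2 * r))
      hc.stronglyMeasurable.integral_prod_right.aestronglyMeasurable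
      (ae_of_all _ fun x => abs_integral_approxId_mul_le hε x (hGb x))
  rw [← integral_const_mul, ← integral_add hI1 (hI2.const_mul _), ← integral_const_mul,
    ← Real.norm_eq_abs]
  refine norm_integral_le_of_norm_le (hFmi.const_mul _) (ae_of_all _ fun x => ?_)
  have hkey : |(∫ y, F y * regKernel ε x (X x) y) + 2 * π * ∫ y, approxId ε x y * G x y| ≤
      A * (∫ y in closedBall c (4 * r), |v y|) * ‖x - c‖ := by
    by_cases h : 2 * r < ‖x - c‖
    · have h0 : (0 : ℝ) ≤ ∫ y in closedBall c (4 * r), |v y| :=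
        integral_nonneg fun _ => abs_nonneg _
      simp only [hG, hX0 x h, regKernel, inner_zero_right, map_zero, zero_mul, mul_zero,
        integral_zero, add_zero, abs_zero]
      positivity
    · have h1 := hA v hv ε hε x (not_lt.1 h) (X x)
      have h2 : (∫ y, F y * regKernel ε x (X x) y) =
          -∫ y, ψ y * regKernel ε x (X x) y * lap v y := by
        rw [← integral_neg]
        congr 1
        funext y
        simp only [hF]
        ring
      rw [h2, ← abs_neg]
      refine le_trans (le_of_eq ?_) (h1.trans ?_)
      · congr 1; ring
      · have h0 : (0 : ℝ) ≤ ∫ y in closedBall c (4 * r), |v y| :=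
          integral_nonneg fun _ => abs_nonneg _
        rw [mul_right_comm]
        gcongr
        exact hXle x
  calc ‖F x * (∫ y, F y * regKernel ε x (X x) y) +
        2 * π * (F x * ∫ y, approxId ε x y * G x y)‖
      = F x * |(∫ y, F y * regKernel ε x (X x) y) + 2 * π * ∫ y, approxId ε x y * G x y| := by
        rw [Real.norm_eq_abs, mul_left_comm, ← mul_add, abs_mul, abs_of_nonneg (hF0 x)]
    _ ≤ F x * (A * (∫ y in closedBall c (4 * r), |v y|) * ‖x - c‖) :=
        mul_le_mul_of_nonneg_left hkey (hF0 x)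
    _ = _ := by ring

end Localization

section MassIdentity

/-- The divergence of a vector field on the plane. -/
noncomputable def divergence (X : Plane → Plane) (y : Plane) : ℝ :=
  ∑ i : Fin 2, fderiv ℝ (fun z => X z i) y (EuclideanSpace.single i 1)

theorem contDiff_coord {X : Plane → Plane} (hX : ContDiff ℝ 1 X) (i : Fin 2) :
    ContDiff ℝ 1 fun z => X z i :=
  contDiff_euclidean.1 hX i

theorem continuous_divergence {X : Plane → Plane} (hX : ContDiff ℝ 1 X) :
    Continuous (divergence X) := by
  unfold divergence
  exact continuous_finsetSum _ fun i _ =>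
    ((contDiff_coord hX i).continuous_fderiv (by norm_num)).clm_apply continuous_const

theorem divergence_congr {X Y : Plane → Plane} {y : Plane} (h : X =ᶠ[𝓝 y] Y) :
    divergence X y = divergence Y y := by
  unfold divergence
  refine Finset.sum_congr rfl fun i _ => ?_
  have : (fun z => X z i) =ᶠ[𝓝 y] fun z => Y z i := h.mono fun z hz => by simp only [hz]
  rw [this.fderiv_eq]

theorem divergence_sub_const (c y : Plane) : divergence (fun z => z - c) y = 2 := by
  have h : ∀ i : Fin 2, fderiv ℝ (fun z : Plane => (z - c) i) y (EuclideanSpace.single i 1) = 1 := by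
    intro i
    have h1 : HasFDerivAt (fun z : Plane => z i - c i)
        (EuclideanSpace.proj i : Plane →L[ℝ] ℝ) y :=
      (EuclideanSpace.proj i : Plane →L[ℝ] ℝ).hasFDerivAt.sub_const _
    have h2 : (fun z : Plane => (z - c) i) = fun z => z i - c i := by funext z; simp
    rw [h2, h1.fderiv]
    simp
  simp only [divergence, h]
  norm_num

theorem divergence_eq_zero_of_notMem_tsupport {X : Plane → Plane} {y : Plane}
    (hy : y ∉ tsupport X) : divergence X y = 0 := by
  rw [divergence_congr (notMem_tsupport_iff_eventuallyEq.1 hy)]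
  simp [divergence]

theorem fderiv_apply_eq_sum (f : Plane → ℝ) (y v : Plane) :
    fderiv ℝ f y v = ∑ i : Fin 2, v i * fderiv ℝ f y (EuclideanSpace.single i 1) := by
  conv_lhs => rw [← (EuclideanSpace.basisFun (Fin 2) ℝ).sum_repr v]
  simp

theorem contDiff_mul_of_tsupport_subset {Ω : Set Plane} (hΩ : IsOpen Ω) {n : ℕ∞} {f g : Plane → ℝ}
    (hf : ContDiffOn ℝ n f Ω) (hg : ContDiff ℝ n g) (hgs : tsupport g ⊆ Ω) :
    ContDiff ℝ n fun y => g y * f y := by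
  refine contDiff_iff_contDiffAt.2 fun y => ?_
  by_cases hy : y ∈ Ω
  · exact hg.contDiffAt.mul (hf.contDiffAt (hΩ.mem_nhds hy))
  · have h0 := notMem_tsupport_iff_eventuallyEq.1 fun h => hy (hgs h)
    refine (contDiffAt_const (c := (0 : ℝ))).congr_of_eventuallyEq ?_
    filter_upwards [h0] with z hz
    rw [hz, Pi.zero_apply, zero_mul]

theorem integrable_mul_of_tsupport_subset {Ω : Set Plane} (hΩ : IsOpen Ω) {f g : Plane → ℝ}
    (hf : ContinuousOn f Ω) (hg : Continuous g) (hgc : HasCompactSupport g)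
    (hgs : tsupport g ⊆ Ω) : Integrable fun y => g y * f y := by
  refine Continuous.integrable_of_hasCompactSupport (continuous_iff_continuousAt.2 fun y => ?_)
    hgc.mul_right
  by_cases hy : y ∈ Ω
  · exact hg.continuousAt.mul (hf.continuousAt (hΩ.mem_nhds hy))
  · have h0 := notMem_tsupport_iff_eventuallyEq.1 fun h => hy (hgs h)
    refine (continuousAt_const (y := (0 : ℝ))).congr ?_
    filter_upwards [h0] with z hz
    rw [hz, Pi.zero_apply, zero_mul]

/-- The divergence theorem for a compactly supported vector field. -/
theorem integral_fderiv_apply_eq_neg_integral_divergence {Ω : Set Plane} (hΩ : IsOpen Ω)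
    {f : Plane → ℝ} (hf : ContDiffOn ℝ 1 f Ω) {X : Plane → Plane} (hX : ContDiff ℝ 1 X)
    (hXc : HasCompactSupport X) (hXs : tsupport X ⊆ Ω) :
    ∫ y, fderiv ℝ f y (X y) = -∫ y, f y * divergence X y := by
  have hs : ∀ i : Fin 2, tsupport (fun z => X z i) ⊆ tsupport X := fun i =>
    closure_mono fun z hz h => hz (by simp [h])
  have hcs : ∀ i : Fin 2, HasCompactSupport fun z => X z i := fun i =>
    HasCompactSupport.intro hXc fun z hz => by simp [image_eq_zero_of_notMem_tsupport hz]
  have hg : ∀ i : Fin 2, ContDiff ℝ 1 fun y => X y i * f y := fun i =>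
    contDiff_mul_of_tsupport_subset hΩ (n := 1) hf (contDiff_coord hX i) ((hs i).trans hXs)
  have hgc : ∀ i : Fin 2, HasCompactSupport fun y => X y i * f y := fun i => (hcs i).mul_right
  have hzero : ∀ i : Fin 2,
      ∫ y, fderiv ℝ (fun z => X z i * f z) y (EuclideanSpace.single i 1) = 0 := fun i => by
    simpa using integral_mul_fderiv_eq_neg (contDiff_const (c := (1 : ℝ))) (hg i) (hgc i)
      (EuclideanSpace.single i 1)
  have hint : ∀ i : Fin 2,
      Integrable fun y => fderiv ℝ (fun z => X z i * f z) y (EuclideanSpace.single i 1) :=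
    fun i => (((hg i).continuous_fderiv (by norm_num)).clm_apply
      continuous_const).integrable_of_hasCompactSupport ((hgc i).fderiv_apply (𝕜 := ℝ) _)
  have hdivs : tsupport (divergence X) ⊆ tsupport X :=
    closure_minimal (fun y hy => by
      by_contra h
      exact hy (divergence_eq_zero_of_notMem_tsupport h)) (isClosed_tsupport X)
  have hdivc : HasCompactSupport (divergence X) :=
    HasCompactSupport.intro hXc fun y hy => divergence_eq_zero_of_notMem_tsupport hy
  have hdi : Integrable fun y => f y * divergence X y := by
    simpa only [mul_comm] using integrable_mul_of_tsupport_subset hΩ hf.continuousOn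
      (continuous_divergence hX) hdivc (hdivs.trans hXs)
  have hpt : ∀ y, fderiv ℝ f y (X y) =
      (∑ i : Fin 2, fderiv ℝ (fun z => X z i * f z) y (EuclideanSpace.single i 1)) -
        f y * divergence X y := fun y => by
    by_cases hy : y ∈ Ω
    · have hfd : DifferentiableAt ℝ f y :=
        (hf.contDiffAt (hΩ.mem_nhds hy)).differentiableAt (by norm_num)
      rw [fderiv_apply_eq_sum, divergence, Finset.mul_sum, ← Finset.sum_sub_distrib]
      refine Finset.sum_congr rfl fun i _ => ?_
      have hXd : DifferentiableAt ℝ (fun z => X z i) y :=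
        (contDiff_coord hX i).differentiable (by norm_num) y
      rw [fderiv_fun_mul hXd hfd]
      simp
    · have hy' : y ∉ tsupport X := fun h => hy (hXs h)
      rw [divergence_eq_zero_of_notMem_tsupport hy', image_eq_zero_of_notMem_tsupport hy', map_zero,
        mul_zero, sub_zero, eq_comm]
      refine Finset.sum_eq_zero fun i _ => ?_
      have : fderiv ℝ (fun z => X z i * f z) y = 0 := image_eq_zero_of_notMem_tsupport fun h =>
        hy' (hs i (tsupport_mul_subset_left (tsupport_fderiv_subset ℝ h)))
      rw [this, zero_apply]
  simp only [hpt]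
  rw [integral_sub (integrable_finsetSum _ fun i _ => hint i) hdi,
    integral_finsetSum _ fun i _ => hint i]
  simp [hzero]

/-- The local Pohozaev identity for `-Δu = V eᵘ`, with quantitative error. -/
theorem exists_abs_mass_identity_le {Ω : Set Plane} (hΩ : IsOpen Ω) {c : Plane} {r : ℝ}
    (hr : 0 < r) (hball : closedBall c (6 * r) ⊆ Ω) {ψ : Plane → ℝ} (hψ : ContDiff ℝ 2 ψ)
    (hψ1 : ∀ y, ‖y - c‖ < 3 * r → ψ y = 1) (hψ0 : tsupport ψ ⊆ closedBall c (4 * r))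
    (hψnn : ∀ y, 0 ≤ ψ y) {X : Plane → Plane} (hX : ContDiff ℝ 1 X)
    (hX0 : ∀ x, 2 * r < ‖x - c‖ → X x = 0) (hXle : ∀ x, ‖X x‖ ≤ ‖x - c‖)
    (hXc : ∀ x, ‖x - c‖ ≤ r → X x = x - c) :
    ∃ A, 0 ≤ A ∧ ∀ (u V : Plane → ℝ) (m : ℝ), ContDiffOn ℝ 2 u Ω → ContDiffOn ℝ 1 V Ω →
      (∀ y ∈ Ω, 0 ≤ V y) → (∀ y ∈ Ω, -lap u y = V y * exp (u y)) →
      IntegrableOn (fun y => |u y - m|) Ω →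
      |1 / 2 * (∫ y, ψ y * (V y * exp (u y))) ^ 2 -
          2 * π * (∫ y, V y * exp (u y) * divergence X y) -
          2 * π * ∫ y, exp (u y) * fderiv ℝ V y (X y)| ≤
        A * ((∫ y, ψ y * (V y * exp (u y))) + ∫ y in Ω, |u y - m|) *
          ∫ y, ψ y * (V y * exp (u y)) * ‖y - c‖ := by
  have hψc : HasCompactSupport ψ :=
    (isCompact_closedBall c (4 * r)).of_isClosed_subset (isClosed_tsupport ψ) hψ0
  have hXs : tsupport X ⊆ closedBall c (2 * r) :=
    closure_minimal (fun y hy => by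
      rw [mem_closedBall, dist_eq_norm]
      by_contra! h
      exact hy (hX0 y h)) isClosed_closedBall
  have hXcs : HasCompactSupport X :=
    (isCompact_closedBall c (2 * r)).of_isClosed_subset (isClosed_tsupport X) hXs
  obtain ⟨M, hM'⟩ := hX.lipschitzWith_of_hasCompactSupport hXcs (by norm_num)
  have hM : ∀ x y, ‖X x - X y‖ ≤ M * ‖x - y‖ := fun x y => hM'.norm_sub_le x y
  have hXΩ : tsupport X ⊆ Ω :=
    hXs.trans ((closedBall_subset_closedBall (by linarith)).trans hball)
  obtain ⟨A, hA0, hA⟩ := exists_abs_integral_symKernel_add_le hr hψ hψc hψ1 hψ0 hX.continuous hM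
    hX0 hXle
  set B : ℝ := (1 + M) / r with hB
  have hB0 : 0 ≤ B := by positivity
  refine ⟨A + B, by positivity, fun u V m hu hV hV0 hpde hui => ?_⟩
  let χ : ContDiffBump c := ⟨5 * r, 6 * r, by linarith, by linarith⟩
  have hχs : tsupport χ ⊆ Ω := χ.tsupport_eq.trans_subset hball
  set v : Plane → ℝ := fun y => χ y * (u y - m) with hv_def
  have hv : ContDiff ℝ 2 v := contDiff_mul_of_tsupport_subset hΩ (n := 2)
    (hu.sub contDiffOn_const) χ.contDiff hχs
  have hloc : ∀ y ∈ closedBall c (4 * r), v =ᶠ[𝓝 y] fun z => u z - m := fun y hy => by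
    have : closedBall c (5 * r) ∈ 𝓝 y := mem_of_superset
      (isOpen_ball.mem_nhds (closedBall_subset_ball (by linarith) hy)) ball_subset_closedBall
    filter_upwards [this] with z hz
    rw [hv_def]
    simp only [χ.one_of_mem_closedBall hz, one_mul]
  have h4Ω : closedBall c (4 * r) ⊆ Ω :=
    (closedBall_subset_closedBall (by linarith)).trans hball
  set f : Plane → ℝ := fun y => V y * exp (u y) with hf_def
  have hf : ContDiffOn ℝ 1 f Ω := hV.mul (hu.of_le (by norm_num)).exp
  have hF : ∀ y, -(ψ y * lap v y) = ψ y * f y := fun y => by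
    by_cases hy : y ∈ closedBall c (4 * r)
    · rw [lap_congr (hloc y hy), lap_sub_const, hf_def]
      simp only [← hpde y (h4Ω hy)]
      ring
    · rw [image_eq_zero_of_notMem_tsupport fun h => hy (hψ0 h)]
      simp
  have hF0 : ∀ y, 0 ≤ ψ y * f y := fun y => by
    by_cases hy : y ∈ closedBall c (4 * r)
    · exact mul_nonneg (hψnn y) (mul_nonneg (hV0 y (h4Ω hy)) (exp_pos _).le)
    · rw [image_eq_zero_of_notMem_tsupport fun h => hy (hψ0 h), zero_mul]
  have hFcont : Continuous fun y => ψ y * f y := by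
    simp only [← hF]
    exact (hψ.continuous.mul (continuous_lap hv)).neg
  have h1 := hA v hv fun y => by rw [hF]; exact hF0 y
  have h2 := abs_integral_symKernel_sub_sq_le hFcont hψc.mul_right hF0 hX.continuous hM hr hXc
  simp only [hF] at h1
  have hvint : ∫ y in closedBall c (4 * r), |v y| ≤ ∫ y in Ω, |u y - m| := by
    rw [setIntegral_congr_fun (g := fun y => |u y - m|) measurableSet_closedBall
      fun y hy => by simp only [(hloc y hy).eq_of_nhds]]
    exact setIntegral_mono_set hui (ae_of_all _ fun _ => abs_nonneg _) h4Ω.eventuallyLE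
  have hdiv := integral_fderiv_apply_eq_neg_integral_divergence hΩ hf hX hXcs hXΩ
  have hdf : ∀ y, fderiv ℝ f y (X y) =
      exp (u y) * fderiv ℝ V y (X y) + ψ y * f y * fderiv ℝ v y (X y) := fun y => by
    by_cases hy : 2 * r < ‖y - c‖
    · simp [hX0 y hy]
    · have hy4 : y ∈ closedBall c (4 * r) := by
        rw [mem_closedBall, dist_eq_norm]; linarith
      have hVd : DifferentiableAt ℝ V y :=
        (hV.contDiffAt (hΩ.mem_nhds (h4Ω hy4))).differentiableAt (by norm_num)
      have hud : DifferentiableAt ℝ u y :=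
        (hu.contDiffAt (hΩ.mem_nhds (h4Ω hy4))).differentiableAt (by norm_num)
      rw [(hloc y hy4).fderiv_eq, fderiv_sub_const, hψ1 y (by linarith), hf_def,
        (hVd.hasFDerivAt.fun_mul hud.hasFDerivAt.exp).fderiv]
      simp
      ring
  have hci : ∀ g : Plane → ℝ, ContDiffOn ℝ 1 g Ω → ∀ h : Plane → ℝ, ContinuousOn h Ω →
      Integrable fun y => h y * fderiv ℝ g y (X y) := fun g hg h hh => by
    refine Continuous.integrable_of_hasCompactSupport (continuous_iff_continuousAt.2 fun y => ?_)
      (HasCompactSupport.intro hXcs fun y hy => by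
        rw [image_eq_zero_of_notMem_tsupport hy, map_zero, mul_zero])
    by_cases hy : y ∈ Ω
    · exact (hh.continuousAt (hΩ.mem_nhds hy)).mul
        (((hg.continuousOn_fderiv_of_isOpen hΩ (by norm_num)).continuousAt
          (hΩ.mem_nhds hy)).clm_apply hX.continuous.continuousAt)
    · refine (continuousAt_const (y := (0 : ℝ))).congr ?_
      filter_upwards [notMem_tsupport_iff_eventuallyEq.1 fun h => hy (hXΩ h)] with z hz
      rw [hz, Pi.zero_apply, map_zero, mul_zero]
  have hsum : (∫ y, exp (u y) * fderiv ℝ V y (X y)) +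
      ∫ y, ψ y * f y * fderiv ℝ v y (X y) = -∫ y, f y * divergence X y := by
    rw [← hdiv, ← integral_add (hci V hV _ hu.continuousOn.rexp)
      (hci v (hv.of_le (by norm_num)).contDiffOn _ hFcont.continuousOn)]
    simp only [hdf]
  have hb0 : 0 ≤ ∫ y, ψ y * f y * ‖y - c‖ :=
    integral_nonneg fun y => mul_nonneg (hF0 y) (norm_nonneg _)
  have ha0 : 0 ≤ ∫ y, ψ y * f y := integral_nonneg hF0
  have hv0 : 0 ≤ ∫ y in Ω, |u y - m| := integral_nonneg fun _ => abs_nonneg _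
  set S := ∫ p : Plane × Plane, ψ p.1 * f p.1 * (ψ p.2 * f p.2) * symKernel 0 X p
  set a := ∫ y, ψ y * f y
  set b := ∫ y, ψ y * f y * ‖y - c‖
  set T := ∫ y, ψ y * f y * fderiv ℝ v y (X y)
  set K := ∫ y in Ω, |u y - m|
  have heq : 1 / 2 * a ^ 2 - 2 * π * (∫ y, f y * divergence X y) -
      2 * π * (∫ y, exp (u y) * fderiv ℝ V y (X y)) =
      (1 / 2 * S + 2 * π * T) - 1 / 2 * (S - a ^ 2) := by
    linear_combination (-(2 * π)) * hsum
  calc _ = |(1 / 2 * S + 2 * π * T) - 1 / 2 * (S - a ^ 2)| := by rw [heq]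
    _ ≤ |1 / 2 * S + 2 * π * T| + |1 / 2 * (S - a ^ 2)| := abs_sub _ _
    _ ≤ A * K * b + 1 / 2 * (2 * (1 + M) / r * (a * b)) := by
      rw [abs_mul (1 / 2), abs_of_pos (one_half_pos (α := ℝ))]
      gcongr
      refine h1.trans ?_
      gcongr
    _ = A * K * b + B * a * b := by rw [hB]; ring
    _ ≤ A * K * b + B * a * b + (A * a * b + B * K * b) := le_add_of_nonneg_right (by positivity)
    _ = _ := by ring

end MassIdentity

section Limit

/-- The `L¹` distance of a supersolution to a suitable constant is controlled by the mass of its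
Laplacian and by its oscillation on the boundary. -/
theorem exists_integral_abs_sub_le {Ω : Set Plane} (hΩ : IsOpen Ω) {R : ℝ}
    (hR : Ω ⊆ closedBall 0 R) {u h : Plane → ℝ} (hu : ContDiffOn ℝ 2 u Ω)
    (huc : ContinuousOn u (closure Ω)) {C : ℝ} (hC : 0 ≤ C)
    (hosc : ∀ x ∈ frontier Ω, ∀ y ∈ frontier Ω, u x - u y ≤ C)
    (hh : ∀ x ∈ Ω, 0 ≤ h x) (hhi : IntegrableOn h Ω) (hlap : ∀ x ∈ Ω, -lap u x = h x) :
    ∃ m : ℝ, IntegrableOn (fun y => |u y - m|) Ω ∧ ∫ y in Ω, |u y - m| ≤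
      R ^ 2 / 4 * (∫ y in Ω, h y) + (4 + 2 * C) * volume.real Ω := by
  have hΩb : Bornology.IsBounded Ω := isBounded_closedBall.subset hR
  have hΩfin : volume Ω ≠ ⊤ := hΩb.measure_lt_top.ne
  have hK : IsCompact (closure Ω) := hΩb.isCompact_closure
  have hint : ∀ g : Plane → ℝ, ContinuousOn g (closure Ω) → IntegrableOn g Ω := fun g hg =>
    (hg.integrableOn_compact hK).mono_set subset_closure
  obtain ⟨m, hm⟩ : ∃ m : ℝ, ∀ y ∈ frontier Ω, m ≤ u y ∧ u y ≤ m + 2 * C := by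
    rcases (frontier Ω).eq_empty_or_nonempty with h0 | ⟨y₀, hy₀⟩
    · exact ⟨0, by simp [h0]⟩
    · exact ⟨u y₀ - C, fun y hy => ⟨by linarith [hosc y₀ hy₀ y hy], by linarith [hosc y hy y₀ hy₀]⟩⟩
  have h1 := setIntegral_posPart_le hΩ hR (w := fun y => u y - (m + 2 * C)) (h := h)
    (hu.sub contDiffOn_const) (huc.sub continuousOn_const)
    (fun y hy => by linarith [(hm y hy).2]) hh hhi
    (fun y hy => by rw [lap_sub_const]; exact (hlap y hy).le)
  have h2 := setIntegral_posPart_le hΩ hR (w := fun y => m - u y) (h := fun _ => 0)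
    (contDiffOn_const.sub hu) (continuousOn_const.sub huc)
    (fun y hy => by linarith [(hm y hy).1]) (fun _ _ => le_rfl) integrableOn_zero
    (fun y hy => by rw [lap_const_sub, neg_neg]; linarith [hlap y hy, hh y hy])
  have hi1 := hint (fun y => max (u y - (m + 2 * C)) 0)
    ((huc.sub continuousOn_const).sup continuousOn_const)
  have hi2 := hint (fun y => max (m - u y) 0)
    ((continuousOn_const.sub huc).sup continuousOn_const)
  have hi12 : IntegrableOn (fun y => max (u y - (m + 2 * C)) 0 + max (m - u y) 0) Ω := hi1.add hi2
  have hi3 : IntegrableOn (fun _ : Plane => 2 * C) Ω := integrableOn_const hΩfin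
  have hi : IntegrableOn (fun y => |u y - m|) Ω := hint _ (huc.sub continuousOn_const).abs
  refine ⟨m, hi, ?_⟩
  calc ∫ y in Ω, |u y - m|
      ≤ ∫ y in Ω, (max (u y - (m + 2 * C)) 0 + max (m - u y) 0 + 2 * C) := by
        refine integral_mono hi (hi12.add hi3) fun y => abs_le.2 ⟨?_, ?_⟩
        · linarith [le_max_right (u y - (m + 2 * C)) 0, le_max_left (m - u y) 0]
        · linarith [le_max_left (u y - (m + 2 * C)) 0, le_max_right (m - u y) 0]
    _ = (∫ y in Ω, max (u y - (m + 2 * C)) 0) + (∫ y in Ω, max (m - u y) 0) +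
          volume.real Ω * (2 * C) := by
        rw [integral_add hi12 hi3, integral_add hi1 hi2, setIntegral_const, smul_eq_mul]
    _ ≤ _ := by
      rw [integral_zero] at h2
      linarith

/-- If `uᵢ → -∞` away from `c`, the first moment of `exp uᵢ` about `c` tends to zero. -/
theorem tendsto_integral_exp_mul_norm {Ω : Set Plane} {c : Plane} {ρ C : ℝ} (hρ : 0 < ρ)
    (hball : closedBall c ρ ⊆ Ω) {u : ℕ → Plane → ℝ} (hu : ∀ i, IntegrableOn (fun y => exp (u i y)) Ω)
    (hint : ∀ i, ∫ y in Ω, exp (u i y) ≤ C)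
    (hunif : ∀ δ > 0, ∀ M : ℝ, ∃ N : ℕ, ∀ i ≥ N, ∀ z ∈ closedBall c ρ \ ball c δ, u i z < M) :
    Tendsto (fun i => ∫ y in closedBall c ρ, exp (u i y) * ‖y - c‖) atTop (𝓝 0) := by
  have hC : 0 ≤ C := (integral_nonneg fun y => (exp_pos (u 0 y)).le).trans (hint 0)
  have hfin : volume (closedBall c ρ) ≠ ⊤ := measure_closedBall_lt_top.ne
  set W := volume.real (closedBall c ρ)
  have hW : 0 ≤ W := measureReal_nonneg
  rw [Metric.tendsto_atTop]
  intro η hη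
  set δ : ℝ := η / (2 * (C + 1))
  set τ : ℝ := η / (4 * (ρ * W + 1))
  have hδ : 0 < δ := by positivity
  have hτ : 0 < τ := by positivity
  obtain ⟨N, hN⟩ := hunif δ hδ (Real.log τ)
  refine ⟨N, fun i hi => ?_⟩
  have hnn : 0 ≤ ∫ y in closedBall c ρ, exp (u i y) * ‖y - c‖ :=
    integral_nonneg fun y => by positivity
  rw [Real.dist_eq, sub_zero, abs_of_nonneg hnn]
  have hpt : ∀ y ∈ closedBall c ρ, exp (u i y) * ‖y - c‖ ≤ δ * exp (u i y) + ρ * τ :=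
    fun y hy => by
      have hyρ : ‖y - c‖ ≤ ρ := by rwa [mem_closedBall, dist_eq_norm] at hy
      have he := exp_pos (u i y)
      by_cases h : y ∈ ball c δ
      · rw [mem_ball, dist_eq_norm] at h
        nlinarith [mul_pos hρ hτ]
      · have h2 : exp (u i y) < τ := by
          rw [← Real.lt_log_iff_exp_lt hτ]
          exact hN i hi y ⟨hy, h⟩
        nlinarith [norm_nonneg (y - c), mul_pos hδ he]
  have hi1 : IntegrableOn (fun y => exp (u i y)) (closedBall c ρ) := (hu i).mono_set hball
  have hi2 : IntegrableOn (fun y => δ * exp (u i y) + ρ * τ) (closedBall c ρ) :=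
    (hi1.const_mul δ).add (integrableOn_const hfin)
  calc ∫ y in closedBall c ρ, exp (u i y) * ‖y - c‖
      ≤ ∫ y in closedBall c ρ, (δ * exp (u i y) + ρ * τ) := by
        refine integral_mono_of_nonneg (ae_of_all _ fun y => by positivity) hi2 ?_
        exact (ae_restrict_iff' measurableSet_closedBall).2 (ae_of_all _ hpt)
    _ = δ * (∫ y in closedBall c ρ, exp (u i y)) + W * (ρ * τ) := by
        rw [integral_add (hi1.const_mul δ) (integrableOn_const hfin), integral_const_mul,
          setIntegral_const, smul_eq_mul]
    _ ≤ δ * C + W * (ρ * τ) := by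
        gcongr
        exact (setIntegral_mono_set (hu i) (ae_of_all _ fun _ => (exp_pos _).le)
          hball.eventuallyLE).trans (hint i)
    _ < δ * (C + 1) + (ρ * W + 1) * τ := by nlinarith
    _ ≤ η := by
        have e1 : δ * (C + 1) = η / 2 := by simp only [δ]; field_simp
        have e2 : (ρ * W + 1) * τ = η / 4 := by
          have : ρ * W + 1 ≠ 0 := by positivity
          simp only [τ]; field_simp
        rw [e1, e2]; linarith

end Limit

/-- Wolansky's mass quantization: under a uniform gradient bound on `V_i`, a uniform bound
on `∫ e^{u_i}`, and a uniform boundary oscillation bound, if `u_i → -∞` locally uniformly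
away from finitely many blow-up points and `V_i e^{u_i} → Σ α_j δ_{x_j}` in the sense of
distributions with `α_j ≥ 4π`, then every mass `α_j` equals `8π`. -/
theorem wolansky_mass_quantization
    (Ω : Set (EuclideanSpace ℝ (Fin 2))) (hΩ_open : IsOpen Ω) (hΩ_bdd : Bornology.IsBounded Ω)
    (b C₁ C₂ C₃ : ℝ) (hb : 0 < b) (hC₁ : 0 < C₁) (hC₂ : 0 < C₂) (hC₃ : 0 < C₃)
    (u V : ℕ → EuclideanSpace ℝ (Fin 2) → ℝ)
    (hu_reg : ∀ i, ContDiffOn ℝ 2 (u i) Ω)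
    (hu_cont : ∀ i, ContinuousOn (u i) (closure Ω))
    (hV_reg : ∀ i, ContDiffOn ℝ 1 (V i) Ω)
    (hV_nonneg : ∀ i, ∀ x ∈ Ω, 0 ≤ V i x)
    (hV_le : ∀ i, ∀ x ∈ Ω, V i x ≤ b)
    (hV_grad : ∀ i, ∀ x ∈ Ω, ‖gradient (V i) x‖ ≤ C₁)
    (hpde : ∀ i, ∀ x ∈ Ω, -lap (u i) x = V i x * exp (u i x))
    (hint : ∀ i, ∫ y in Ω, exp (u i y) ≤ C₂)
    (hosc : ∀ i, ∀ x ∈ frontier Ω, ∀ y ∈ frontier Ω, u i x - u i y ≤ C₃)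
    (m : ℕ) (x : Fin m → EuclideanSpace ℝ (Fin 2)) (α : Fin m → ℝ)
    (hx_mem : ∀ j, x j ∈ Ω)
    (hx_distinct : Function.Injective x)
    (hα : ∀ j, 4 * π ≤ α j)
    (hunif : ∀ K : Set (EuclideanSpace ℝ (Fin 2)), IsCompact K →
      K ⊆ Ω \ Set.range x → ∀ M : ℝ, ∃ N : ℕ, ∀ i ≥ N, ∀ z ∈ K, u i z < M)
    (hconv : ∀ φ : EuclideanSpace ℝ (Fin 2) → ℝ, Continuous φ → HasCompactSupport φ →
      tsupport φ ⊆ Ω →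
      Tendsto (fun i => ∫ y in Ω, φ y * (V i y * exp (u i y))) atTop
        (𝓝 (∑ j, α j * φ (x j)))) :
    ∀ j, α j = 8 * π := by
  intro j
  obtain ⟨R, hR⟩ := hΩ_bdd.subset_closedBall (0 : Plane)
  have hΩfin : volume Ω ≠ ⊤ := hΩ_bdd.measure_lt_top.ne
  have hexp : ∀ i, IntegrableOn (fun y => exp (u i y)) Ω := fun i =>
    ((hu_cont i).rexp.integrableOn_compact hΩ_bdd.isCompact_closure).mono_set subset_closure
  have hfcont : ∀ i, ContinuousOn (fun y => V i y * exp (u i y)) Ω := fun i =>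
    (hV_reg i).continuousOn.mul (hu_reg i).continuousOn.rexp
  have hf0 : ∀ i, ∀ y ∈ Ω, 0 ≤ V i y * exp (u i y) := fun i y hy =>
    mul_nonneg (hV_nonneg i y hy) (exp_pos _).le
  have hfle : ∀ i, ∀ y ∈ Ω, V i y * exp (u i y) ≤ b * exp (u i y) := fun i y hy =>
    mul_le_mul_of_nonneg_right (hV_le i y hy) (exp_pos _).le
  have hfi : ∀ i, IntegrableOn (fun y => V i y * exp (u i y)) Ω := fun i => by
    refine ((hexp i).const_mul b).mono'
      ((hfcont i).aestronglyMeasurable hΩ_open.measurableSet) ?_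
    refine (ae_restrict_iff' hΩ_open.measurableSet).2 (ae_of_all _ fun y hy => ?_)
    rw [Real.norm_of_nonneg (hf0 i y hy)]
    exact hfle i y hy
  have hfint : ∀ i, ∫ y in Ω, V i y * exp (u i y) ≤ b * C₂ := fun i => by
    calc _ ≤ ∫ y in Ω, b * exp (u i y) :=
          setIntegral_mono_on (hfi i) ((hexp i).const_mul b) hΩ_open.measurableSet (hfle i)
      _ = b * ∫ y in Ω, exp (u i y) := integral_const_mul _ _
      _ ≤ b * C₂ := by gcongr; exact hint i
  choose μ hμi hμ using fun i => exists_integral_abs_sub_le hΩ_open hR (hu_reg i) (hu_cont i)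
    hC₃.le (hosc i) (hf0 i) (hfi i) (hpde i)
  set K : ℝ := R ^ 2 / 4 * (b * C₂) + (4 + 2 * C₃) * volume.real Ω
  have hK : ∀ i, ∫ y in Ω, |u i y - μ i| ≤ K := fun i => by
    refine (hμ i).trans ?_
    simp only [K]
    gcongr
    exact hfint i
  obtain ⟨ρ, hρ, hρs⟩ : ∃ ρ > 0, closedBall (x j) ρ ⊆ Ω ∩ (x '' {j}ᶜ)ᶜ := by
    refine nhds_basis_closedBall.mem_iff.1 (IsOpen.mem_nhds ?_ ⟨hx_mem j, ?_⟩)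
    · exact hΩ_open.inter ((Set.toFinite _).isClosed.isOpen_compl)
    · rintro ⟨k, hk, hkj⟩
      exact hk (hx_distinct hkj)
  set c := x j
  obtain ⟨r, hr, rfl⟩ : ∃ r > 0, ρ = 6 * r := ⟨ρ / 6, by positivity, by ring⟩
  have hball : closedBall c (6 * r) ⊆ Ω := fun y hy => (hρs hy).1
  have hfar : ∀ k, k ≠ j → x k ∉ closedBall c (6 * r) := fun k hk h => (hρs h).2 ⟨k, hk, rfl⟩
  let φ : ContDiffBump c := ⟨r, 2 * r, hr, by linarith⟩
  let ψ : ContDiffBump c := ⟨3 * r, 4 * r, by linarith, by linarith⟩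
  set X : Plane → Plane := fun y => φ y • (y - c) with hX_def
  have hX : ContDiff ℝ 1 X := φ.contDiff.smul (contDiff_id.sub contDiff_const)
  have hX0 : ∀ y, 2 * r < ‖y - c‖ → X y = 0 := fun y hy => by
    simp only [hX_def, φ.zero_of_le_dist (show 2 * r ≤ dist y c by rw [dist_eq_norm]; exact hy.le),
      zero_smul]
  have hXle : ∀ y, ‖X y‖ ≤ ‖y - c‖ := fun y => by
    rw [hX_def, norm_smul, Real.norm_of_nonneg φ.nonneg]
    exact mul_le_of_le_one_left (norm_nonneg _) φ.le_one
  have hXc : ∀ y, ‖y - c‖ ≤ r → X y = y - c := fun y hy => by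
    simp only [hX_def, φ.one_of_mem_closedBall (show y ∈ closedBall c r by
      rwa [mem_closedBall, dist_eq_norm]), one_smul]
  have hψs : tsupport ψ ⊆ closedBall c (4 * r) := ψ.tsupport_eq.subset
  have hψ1 : ∀ y, ‖y - c‖ < 3 * r → ψ y = 1 := fun y hy =>
    ψ.one_of_mem_closedBall (show y ∈ closedBall c (3 * r) by
      rw [mem_closedBall, dist_eq_norm]; exact hy.le)
  obtain ⟨A, hA0, hA⟩ := exists_abs_mass_identity_le hΩ_open hr hball ψ.contDiff hψ1 hψs
    (fun y => ψ.nonneg) hX hX0 hXle hXc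
  have hlim : ∀ g : Plane → ℝ, Continuous g → tsupport g ⊆ closedBall c (4 * r) →
      Tendsto (fun i => ∫ y, g y * (V i y * exp (u i y))) atTop (𝓝 (α j * g c)) := by
    intro g hg hgs
    have h4 : closedBall c (4 * r) ⊆ closedBall c (6 * r) := closedBall_subset_closedBall (by linarith)
    have hgΩ := (hgs.trans h4).trans hball
    have h := hconv g hg
      ((isCompact_closedBall c (4 * r)).of_isClosed_subset (isClosed_tsupport g) hgs) hgΩ
    rw [Finset.sum_eq_single_of_mem j (Finset.mem_univ j) fun k _ hk => by
      rw [image_eq_zero_of_notMem_tsupport fun hm => hfar k hk (h4 (hgs hm)), mul_zero]] at h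
    refine h.congr fun i => setIntegral_eq_integral_of_forall_compl_eq_zero fun y hy => ?_
    rw [image_eq_zero_of_notMem_tsupport fun hm => hy (hgΩ hm), zero_mul]
  have hlima : Tendsto (fun i => ∫ y, ψ y * (V i y * exp (u i y))) atTop (𝓝 (α j)) := by
    simpa [hψ1 c (by simpa using hr)] using hlim ψ ψ.continuous hψs
  have hlimb : Tendsto (fun i => ∫ y, ψ y * (V i y * exp (u i y)) * ‖y - c‖) atTop (𝓝 0) := by
    have h := hlim (fun y => ψ y * ‖y - c‖) (ψ.continuous.mul (by fun_prop))
      ((tsupport_mul_subset_left).trans hψs)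
    simp only [sub_self, norm_zero, mul_zero] at h
    refine h.congr fun i => ?_
    simp only [mul_right_comm]
  have hXs : tsupport X ⊆ closedBall c (2 * r) :=
    closure_minimal (fun y hy => by
      rw [mem_closedBall, dist_eq_norm]
      by_contra! h
      exact hy (hX0 y h)) isClosed_closedBall
  have hlimd : Tendsto (fun i => ∫ y, V i y * exp (u i y) * divergence X y) atTop
      (𝓝 (α j * 2)) := by
    have hc2 : divergence X c = 2 := by
      rw [divergence_congr (Y := fun z => z - c), divergence_sub_const]
      filter_upwards [closedBall_mem_nhds c hr] with y hy
      exact hXc y (by rwa [mem_closedBall, dist_eq_norm] at hy)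
    have h := hlim (divergence X) (continuous_divergence hX)
      (closure_minimal (fun y hy => closedBall_subset_closedBall (by linarith) (hXs (by
        by_contra h
        exact hy (divergence_eq_zero_of_notMem_tsupport h)))) isClosed_closedBall)
    rw [hc2] at h
    simpa only [mul_comm] using h
  have h2Ω : closedBall c (2 * r) ⊆ Ω := (closedBall_subset_closedBall (by linarith)).trans hball
  have hlimg : Tendsto (fun i => ∫ y, exp (u i y) * fderiv ℝ (V i) y (X y)) atTop (𝓝 0) := by
    have h := (tendsto_integral_exp_mul_norm (by linarith : 0 < 2 * r) h2Ω hexp hint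
      fun δ hδ M => hunif _ ((isCompact_closedBall _ _).diff isOpen_ball) (by
        rintro y ⟨hy, hyδ⟩
        refine ⟨h2Ω hy, ?_⟩
        rintro ⟨k, rfl⟩
        by_cases hk : k = j
        · subst hk
          exact hyδ (mem_ball_self hδ)
        · exact hfar k hk (closedBall_subset_closedBall (by linarith) hy)) M).const_mul C₁
    rw [mul_zero] at h
    refine squeeze_zero_norm (fun i => ?_) h
    rw [← setIntegral_eq_integral_of_forall_compl_eq_zero (s := closedBall c (2 * r)) fun y hy => by
      rw [image_eq_zero_of_notMem_tsupport fun hm => hy (hXs hm), map_zero, mul_zero],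
      ← integral_const_mul]
    have hi : IntegrableOn (fun y => exp (u i y) * ‖y - c‖) (closedBall c (2 * r)) :=
      (((hu_reg i).continuousOn.mono h2Ω).rexp.mul (by fun_prop)).integrableOn_compact
        (isCompact_closedBall _ _)
    refine norm_integral_le_of_norm_le (hi.const_mul C₁) ?_
    refine (ae_restrict_iff' measurableSet_closedBall).2 (ae_of_all _ fun y hy => ?_)
    have hg : ‖fderiv ℝ (V i) y‖ ≤ C₁ := by
      have := hV_grad i y (h2Ω hy)
      rwa [gradient, LinearIsometryEquiv.norm_map] at this
    rw [norm_mul, Real.norm_of_nonneg (exp_pos _).le, mul_left_comm]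
    gcongr
    exact ((fderiv ℝ (V i) y).le_opNorm (X y)).trans
      (mul_le_mul hg (hXle y) (norm_nonneg _) hC₁.le)
  have hleft := ((((hlima.pow 2).const_mul (1 / 2)).sub (hlimd.const_mul (2 * π))).sub
    (hlimg.const_mul (2 * π))).abs
  have hright := ((hlima.add_const K).const_mul A).mul hlimb
  have hle := le_of_tendsto_of_tendsto' hleft hright fun i => by
    refine (hA (u i) (V i) (μ i) (hu_reg i) (hV_reg i) (hV_nonneg i) (hpde i) (hμi i)).trans ?_
    have hb0 : 0 ≤ ∫ y, ψ y * (V i y * exp (u i y)) * ‖y - c‖ := integral_nonneg fun y => by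
      by_cases hy : y ∈ Ω
      · exact mul_nonneg (mul_nonneg ψ.nonneg (hf0 i y hy)) (norm_nonneg _)
      · have : ψ y = 0 := image_eq_zero_of_notMem_tsupport fun hm =>
          hy (hball (closedBall_subset_closedBall (by linarith) (hψs hm)))
        simp [this]
    gcongr
    exact hK i
  rw [mul_zero, mul_zero, sub_zero] at hle
  have hz := abs_nonpos_iff.1 hle
  have hα0 : α j ≠ 0 := (lt_of_lt_of_le (by positivity) (hα j)).ne'
  have hfac : α j * (α j - 8 * π) = 0 := by linear_combination 2 * hz
  linarith [(mul_eq_zero.1 hfac).resolve_left hα0]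
end
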